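/- arXiv:2510.25734 — 3 statements merged into one kernel-verified Lean document; each statement's English description precedes it below -/
import Mathlib

section
/- For every s ≥ 4 and r ≥ 2, RKG_r(s-1,s) ≤ r·R(s-2,s) + 2(R(s-2,s-1) - 1) + 2r; i.e., every red/blue edge-coloring of KG(r·R(s-2,s) + 2R(s-2,s-1) + 2r - 2, r) contains a red clique of size s-1 or a blue clique of size s. -/
open Finset

/-- A clique in the Kneser graph `KG(n,r)`: a family of pairwise disjoint
`r`-element subsets of `[n] = {0, …, n-1}`. -/
def IsKneserClique (n r : ℕ) (S : Finset (Finset ℕ)) : Prop :=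
  (∀ A ∈ S, A ⊆ Finset.range n ∧ A.card = r) ∧
  (S : Set (Finset ℕ)).Pairwise Disjoint

/-- A clique all of whose edges get color `b` under the edge-coloring `c`. -/
def MonoClique (c : Finset ℕ → Finset ℕ → Bool) (b : Bool) (S : Finset (Finset ℕ)) : Prop :=
  ∀ A ∈ S, ∀ B ∈ S, A ≠ B → c A B = b

/-- `n` is Ramsey for the Kneser graph `KG(n,r)`: every red/blue edge-coloring
contains a red `s`-clique or a blue `t`-clique. -/
def KneserRamseyProp (n r s t : ℕ) : Prop :=
  ∀ c : Finset ℕ → Finset ℕ → Bool, (∀ A B, c A B = c B A) →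
    (∃ S : Finset (Finset ℕ), IsKneserClique n r S ∧ S.card = s ∧ MonoClique c true S) ∨
    (∃ S : Finset (Finset ℕ), IsKneserClique n r S ∧ S.card = t ∧ MonoClique c false S)

/-- The `r`-Kneser Ramsey number `RKG_r(s,t)`. -/
noncomputable def RKG (r s t : ℕ) : ℕ := sInf {n | KneserRamseyProp n r s t}

/-- `n` is Ramsey for `(s,t)`: every red/blue edge-coloring of the complete
graph on `[n]` contains a red `K_s` or a blue `K_t`. -/
def RamseyProp (n s t : ℕ) : Prop :=
  ∀ c : ℕ → ℕ → Bool, (∀ u v, c u v = c v u) →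
    (∃ S : Finset ℕ, S ⊆ Finset.range n ∧ S.card = s ∧
      ∀ u ∈ S, ∀ v ∈ S, u ≠ v → c u v = true) ∨
    (∃ S : Finset ℕ, S ⊆ Finset.range n ∧ S.card = t ∧
      ∀ u ∈ S, ∀ v ∈ S, u ≠ v → c u v = false)

/-- The classical Ramsey number `R(s,t)`. -/
noncomputable def ramseyNumber (s t : ℕ) : ℕ := sInf {n | RamseyProp n s t}


section ChainComplex

variable {R : Type*} [CommRing R] {α β : Type*}

/-- Prepending a vertex to every list of a chain. -/
noncomputable def consChain (R : Type*) [CommRing R] {α : Type*} (a : α) :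
    (List α →₀ R) →ₗ[R] (List α →₀ R) :=
  Finsupp.lmapDomain R R (List.cons a)

@[simp] lemma consChain_single (a : α) (l : List α) (x : R) :
    consChain R a (Finsupp.single l x) = Finsupp.single (a :: l) x := by
  simp [consChain]

/-- The boundary of a list. -/
noncomputable def listBoundary (R : Type*) [CommRing R] {α : Type*} : List α → (List α →₀ R)
  | [] => 0
  | a :: l => Finsupp.single l 1 - consChain R a (listBoundary R l)

/-- The augmented boundary map on chains of lists. -/
noncomputable def boundary (R : Type*) [CommRing R] (α : Type*) :
    (List α →₀ R) →ₗ[R] (List α →₀ R) :=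
  Finsupp.linearCombination R (listBoundary R)

@[simp] lemma boundary_single_nil (x : R) :
    boundary R α (Finsupp.single [] x) = 0 := by
  simp [boundary, listBoundary]

lemma boundary_single_cons (a : α) (l : List α) :
    boundary R α (Finsupp.single (a :: l) 1) =
      Finsupp.single l 1 - consChain R a (boundary R α (Finsupp.single l 1)) := by
  simp [boundary, listBoundary]

lemma boundary_consChain (a : α) (f : List α →₀ R) :
    boundary R α (consChain R a f) = f - consChain R a (boundary R α f) := by
  have h : boundary R α ∘ₗ consChain R a = LinearMap.id - consChain R a ∘ₗ boundary R α := by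
    ext l : 2
    simp [boundary_single_cons]
  exact LinearMap.congr_fun h f

lemma boundary_boundary (f : List α →₀ R) : boundary R α (boundary R α f) = 0 := by
  have h : boundary R α ∘ₗ boundary R α = 0 := by
    refine Finsupp.lhom_ext' fun l => LinearMap.ext_ring ?_
    induction l with
    | nil => simp
    | cons a l ih =>
      simp only [LinearMap.comp_apply, Finsupp.lsingle_apply, LinearMap.zero_apply] at ih ⊢
      simp [boundary_single_cons, boundary_consChain, ih]
  exact LinearMap.congr_fun h f

/-- The chain map induced by a map of vertices. -/
noncomputable def mapChain (R : Type*) [CommRing R] {α β : Type*} (φ : α → β) :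
    (List α →₀ R) →ₗ[R] (List β →₀ R) :=
  Finsupp.lmapDomain R R (List.map φ)

@[simp] lemma mapChain_single (φ : α → β) (l : List α) (x : R) :
    mapChain R φ (Finsupp.single l x) = Finsupp.single (l.map φ) x := by
  simp [mapChain]

lemma mapChain_consChain (φ : α → β) (a : α) (f : List α →₀ R) :
    mapChain R φ (consChain R a f) = consChain R (φ a) (mapChain R φ f) := by
  have h : mapChain R φ ∘ₗ consChain R a = consChain R (φ a) ∘ₗ mapChain R φ := by
    ext l : 2
    simp
  exact LinearMap.congr_fun h f

lemma boundary_mapChain (φ : α → β) (f : List α →₀ R) :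
    boundary R β (mapChain R φ f) = mapChain R φ (boundary R α f) := by
  have h : boundary R β ∘ₗ mapChain R φ = mapChain R φ ∘ₗ boundary R α := by
    refine Finsupp.lhom_ext' fun l => LinearMap.ext_ring ?_
    induction l with
    | nil => simp
    | cons a l ih =>
      simp only [LinearMap.comp_apply, Finsupp.lsingle_apply, mapChain_single] at ih ⊢
      simp [boundary_single_cons, mapChain_consChain, ih]
  exact LinearMap.congr_fun h f

lemma mapChain_comp {γ : Type*} (ψ : β → γ) (φ : α → β) (f : List α →₀ R) :
    mapChain R ψ (mapChain R φ f) = mapChain R (ψ ∘ φ) f := by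
  have h : mapChain R ψ ∘ₗ mapChain R φ = mapChain R (ψ ∘ φ) := by
    ext l : 2
    simp
  exact LinearMap.congr_fun h f

lemma mapChain_pow (g : α → α) (i : ℕ) : (mapChain R g) ^ i = mapChain R (g^[i]) := by
  induction i with
  | zero =>
    ext l : 2
    simp
  | succ i ih =>
    ext l : 2
    simp [pow_succ, ih, Function.iterate_succ]

/-- The prism of a list along a vertex map `u`. -/
noncomputable def listPrism (R : Type*) [CommRing R] {α : Type*} (u : α → α) :
    List α → (List α →₀ R)
  | [] => 0
  | x :: l => Finsupp.single (x :: u x :: l.map u) 1 - consChain R x (listPrism R u l)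

/-- The prism operator, a homotopy from the identity to `mapChain u`. -/
noncomputable def prism (R : Type*) [CommRing R] {α : Type*} (u : α → α) :
    (List α →₀ R) →ₗ[R] (List α →₀ R) :=
  Finsupp.linearCombination R (listPrism R u)

lemma prism_single_cons (u : α → α) (a : α) (l : List α) :
    prism R u (Finsupp.single (a :: l) 1) =
      Finsupp.single (a :: u a :: l.map u) 1 - consChain R a (prism R u (Finsupp.single l 1)) := by
  simp [prism, listPrism]

lemma prism_consChain (u : α → α) (a : α) (f : List α →₀ R) :
    prism R u (consChain R a f) =
      consChain R a (consChain R (u a) (mapChain R u f)) - consChain R a (prism R u f) := by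
  have h : prism R u ∘ₗ consChain R a =
      consChain R a ∘ₗ consChain R (u a) ∘ₗ mapChain R u - consChain R a ∘ₗ prism R u := by
    ext l : 2
    simp [prism_single_cons]
  exact LinearMap.congr_fun h f

lemma boundary_prism (u : α → α) (f : List α →₀ R) :
    boundary R α (prism R u f) = mapChain R u f - f - prism R u (boundary R α f) := by
  have h : boundary R α ∘ₗ prism R u =
      mapChain R u - LinearMap.id - prism R u ∘ₗ boundary R α := by
    refine Finsupp.lhom_ext' fun l => LinearMap.ext_ring ?_
    induction l with
    | nil => simp [prism, listPrism]
    | cons a l ih =>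
      simp only [LinearMap.comp_apply, Finsupp.lsingle_apply, LinearMap.sub_apply,
        LinearMap.id_apply, mapChain_single] at ih ⊢
      have h1 := boundary_mapChain (R := R) u (Finsupp.single l 1)
      rw [mapChain_single] at h1
      simp only [prism_single_cons, boundary_single_cons, map_sub, boundary_consChain, ih,
        prism_consChain, h1, consChain_single, List.map_cons]
      abel
  exact LinearMap.congr_fun h f

/-- The contraction of the chain complex onto `v` along `u`. -/
noncomputable def contraction (R : Type*) [CommRing R] {α : Type*} (v : α) (u : α → α) :
    (List α →₀ R) →ₗ[R] (List α →₀ R) :=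
  consChain R v ∘ₗ mapChain R u - prism R u

lemma boundary_contraction (v : α) (u : α → α) (f : List α →₀ R) :
    boundary R α (contraction R v u f) = f - contraction R v u (boundary R α f) := by
  simp only [contraction, LinearMap.sub_apply, LinearMap.comp_apply, map_sub, boundary_consChain,
    boundary_prism, boundary_mapChain]
  abel

/-- The operators `g - 1` (even index) and `1 + g + ⋯ + g ^ (p - 1)` (odd index) on chains. -/
noncomputable def cyclicOp (R : Type*) [CommRing R] {α : Type*} (p : ℕ) (g : α → α) (j : ℕ) :
    Module.End R (List α →₀ R) :=
  if Even j then mapChain R g - 1 else ∑ i ∈ Finset.range p, mapChain R g ^ i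

lemma cyclicOp_succ_mul (p : ℕ) (g : α → α) (hg : g^[p] = id) (j : ℕ) :
    cyclicOp R p g (j + 1) * cyclicOp R p g j = 0 := by
  have h1 : (mapChain R g) ^ p = 1 := by
    rw [mapChain_pow, hg]
    ext l : 2
    simp
  rcases Nat.even_or_odd j with hj | hj
  · have hj' : ¬ Even (j + 1) := by simpa [Nat.even_add_one] using hj
    simp only [cyclicOp, hj, hj', if_true, if_false]
    have h := geom_sum_mul (R := Module.End R (List α →₀ R)) (mapChain R g) p
    rw [h1, sub_self] at h
    exact h
  · have hj' : Even (j + 1) := hj.add_one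
    have hj2 : ¬ Even j := by simpa using hj
    simp only [cyclicOp, hj2, hj', if_true, if_false]
    have h := mul_geom_sum (R := Module.End R (List α →₀ R)) (mapChain R g) p
    rw [h1, sub_self] at h
    exact h

lemma mapChain_pow_apply_comm (φ : α → β) (g : α → α) (g' : β → β) (h : ∀ x, φ (g x) = g' (φ x))
    (i : ℕ) (f : List α →₀ R) :
    mapChain R φ ((mapChain R g ^ i) f) = (mapChain R g' ^ i) (mapChain R φ f) := by
  rw [mapChain_pow, mapChain_pow, mapChain_comp, mapChain_comp]
  congr 2
  have : Function.Semiconj φ g g' := h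
  exact (this.iterate_right i).comp_eq

lemma mapChain_cyclicOp (p : ℕ) (φ : α → β) (g : α → α) (g' : β → β)
    (h : ∀ x, φ (g x) = g' (φ x)) (j : ℕ) (f : List α →₀ R) :
    mapChain R φ (cyclicOp R p g j f) = cyclicOp R p g' j (mapChain R φ f) := by
  unfold cyclicOp
  split_ifs
  · have := mapChain_pow_apply_comm (R := R) φ g g' h 1 f
    simp only [pow_one] at this
    simp [this]
  · simp [LinearMap.sum_apply, mapChain_pow_apply_comm φ g g' h]

lemma boundary_pow_mapChain (g : α → α) (i : ℕ) (f : List α →₀ R) :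
    boundary R α ((mapChain R g ^ i) f) = (mapChain R g ^ i) (boundary R α f) := by
  rw [mapChain_pow, boundary_mapChain]

lemma boundary_cyclicOp (p : ℕ) (g : α → α) (j : ℕ) (f : List α →₀ R) :
    boundary R α (cyclicOp R p g j f) = cyclicOp R p g j (boundary R α f) := by
  unfold cyclicOp
  split_ifs
  · simp [boundary_mapChain]
  · simp [LinearMap.sum_apply, boundary_pow_mapChain]

lemma mem_supported_of_single {γ δ : Type*} {s : Set γ} {t : Set δ}
    (L : (γ →₀ R) →ₗ[R] (δ →₀ R))
    (h : ∀ a ∈ s, L (Finsupp.single a 1) ∈ Finsupp.supported R R t) {f : γ →₀ R}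
    (hf : f ∈ Finsupp.supported R R s) : L f ∈ Finsupp.supported R R t := by
  rw [Finsupp.supported_eq_span_single] at hf
  have : Submodule.span R ((fun a => Finsupp.single a (1 : R)) '' s) ≤
      (Finsupp.supported R R t).comap L := by
    rw [Submodule.span_le]
    rintro _ ⟨a, ha, rfl⟩
    exact h a ha
  exact this hf

lemma cyclicOp_mem_supported (p : ℕ) (g : α → α) (j : ℕ) {s : Set (List α)}
    (hs : ∀ l ∈ s, l.map g ∈ s) {f : List α →₀ R} (hf : f ∈ Finsupp.supported R R s) :
    cyclicOp R p g j f ∈ Finsupp.supported R R s := by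
  have hg : ∀ f ∈ Finsupp.supported R R s, mapChain R g f ∈ Finsupp.supported R R s :=
    fun f hf => mem_supported_of_single _ (fun l hl => by
      rw [mapChain_single]; exact Finsupp.single_mem_supported R _ (hs l hl)) hf
  have hp : ∀ i, (mapChain R g ^ i) f ∈ Finsupp.supported R R s := by
    intro i
    induction i with
    | zero => simpa using hf
    | succ i ih =>
      rw [pow_succ', Module.End.mul_apply]
      exact hg _ ih
  unfold cyclicOp
  split_ifs
  · exact Submodule.sub_mem _ (hg f hf) hf
  · rw [LinearMap.sum_apply]
    exact Submodule.sum_mem _ fun i _ => hp i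

end ChainComplex

section CyclicExactness

variable {R : Type*} [CommRing R] {p : ℕ}

/-- The generator of the cyclic action on signed labels. -/
def shiftLabel (x : ZMod p × ℕ) : ZMod p × ℕ := (x.1 + 1, x.2)

lemma iterate_shiftLabel (i : ℕ) (x : ZMod p × ℕ) :
    shiftLabel^[i] x = (x.1 + i, x.2) := by
  induction i with
  | zero => simp
  | succ i ih =>
    rw [Function.iterate_succ_apply', ih]
    simp [shiftLabel, add_assoc]

/-- The sign of the first label of a list. -/
def headSign (l : List (ZMod p × ℕ)) : ZMod p := (l.head?.map Prod.fst).getD 0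

lemma headSign_map_iterate {l : List (ZMod p × ℕ)} (hl : l ≠ []) (i : ℕ) :
    headSign (l.map shiftLabel^[i]) = headSign l + i := by
  cases l with
  | nil => exact absurd rfl hl
  | cons a l => simp [headSign, iterate_shiftLabel]

/-- The part of a chain whose lists have head sign `z`. -/
noncomputable def signPart (R : Type*) [CommRing R] (z : ZMod p) :
    (List (ZMod p × ℕ) →₀ R) →ₗ[R] (List (ZMod p × ℕ) →₀ R) :=
  Finsupp.linearCombination R fun l => if headSign l = z then Finsupp.single l 1 else 0

lemma signPart_mem_supported (z : ZMod p) {s : Set (List (ZMod p × ℕ))}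
    {f : List (ZMod p × ℕ) →₀ R} (hf : f ∈ Finsupp.supported R R s) :
    signPart R z f ∈ Finsupp.supported R R s := by
  refine mem_supported_of_single _ (fun l hl => ?_) hf
  simp only [signPart, Finsupp.linearCombination_single, one_smul]
  split_ifs
  · exact Finsupp.single_mem_supported R _ hl
  · exact Submodule.zero_mem _

lemma sum_range_cast_zmod [NeZero p] {M : Type*} [AddCommMonoid M] (F : ZMod p → M) :
    ∑ i ∈ Finset.range p, F i = ∑ z, F z := by
  refine Finset.sum_bij' (fun i _ => (i : ZMod p)) (fun z _ => z.val) ?_ ?_ ?_ ?_ ?_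
  · simp
  · intro z _
    simpa using ZMod.val_lt z
  · intro i hi
    exact ZMod.val_cast_of_lt (by simpa using hi)
  · intro z _
    exact ZMod.natCast_zmod_val z
  · simp

lemma sum_signPart [NeZero p] (f : List (ZMod p × ℕ) →₀ R) : ∑ z, signPart R z f = f := by
  have h : ∑ z : ZMod p, signPart R z = LinearMap.id := by
    ext l : 2
    simp [signPart]
  simpa [LinearMap.sum_apply] using LinearMap.congr_fun h f

lemma signPart_pow {s : Set (List (ZMod p × ℕ))} (hs : [] ∉ s)
    {f : List (ZMod p × ℕ) →₀ R} (hf : f ∈ Finsupp.supported R R s) (z : ZMod p) (i : ℕ) :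
    signPart R (z + (i : ZMod p)) ((mapChain R shiftLabel ^ i) f) =
      (mapChain R shiftLabel ^ i) (signPart R z f) := by
  rw [Finsupp.supported_eq_span_single] at hf
  have : Set.EqOn (signPart R (z + (i : ZMod p)) ∘ₗ (mapChain R (shiftLabel (p := p)) ^ i))
      ((mapChain R shiftLabel ^ i) ∘ₗ signPart R z)
      (Submodule.span R ((fun a => Finsupp.single a (1 : R)) '' s)) := by
    refine LinearMap.eqOn_span' ?_
    rintro _ ⟨l, hl, rfl⟩
    have hl' : l ≠ [] := fun h => hs (h ▸ hl)
    simp only [mapChain_pow, LinearMap.comp_apply, mapChain_single, signPart,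
      Finsupp.linearCombination_single, one_smul, headSign_map_iterate hl', add_left_inj]
    split_ifs <;> simp
  exact this hf

lemma exists_eq_cyclicOp_of_cyclicOp_eq_zero [NeZero p] {s : Set (List (ZMod p × ℕ))}
    (hs : [] ∉ s) (hinv : ∀ l ∈ s, l.map shiftLabel ∈ s)
    {f : List (ZMod p × ℕ) →₀ R} (hf : f ∈ Finsupp.supported R R s) (j : ℕ)
    (h0 : cyclicOp R p shiftLabel j f = 0) :
    ∃ b ∈ Finsupp.supported R R s, f = cyclicOp R p shiftLabel (j + 1) b := by
  have hpow : ∀ (i : ℕ), ∀ f ∈ Finsupp.supported R R s,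
      (mapChain R shiftLabel ^ i) f ∈ Finsupp.supported R R s := by
    intro i f hf
    induction i with
    | zero => simpa using hf
    | succ i ih =>
      rw [pow_succ', Module.End.mul_apply]
      exact mem_supported_of_single _ (fun l hl => by
        rw [mapChain_single]; exact Finsupp.single_mem_supported R _ (hinv l hl)) ih
  rcases Nat.even_or_odd j with hj | hj
  · have hj' : ¬ Even (j + 1) := by simpa [Nat.even_add_one] using hj
    simp only [cyclicOp, hj, hj', if_true, if_false] at h0 ⊢
    have hfix : ∀ i : ℕ, (mapChain R shiftLabel ^ i) f = f := by
      intro i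
      induction i with
      | zero => simp
      | succ i ih =>
        rw [pow_succ', Module.End.mul_apply, ih]
        simpa [sub_eq_zero] using h0
    refine ⟨signPart R 0 f, signPart_mem_supported 0 hf, ?_⟩
    rw [LinearMap.sum_apply]
    conv_lhs => rw [← sum_signPart f, ← sum_range_cast_zmod]
    refine Finset.sum_congr rfl fun i _ => ?_
    rw [← signPart_pow hs hf, hfix, zero_add]
  · have hj' : Even (j + 1) := hj.add_one
    have hj2 : ¬ Even j := by simpa using hj
    simp only [cyclicOp, hj2, hj', if_true, if_false] at h0 ⊢
    refine ⟨-∑ i ∈ Finset.range p, (∑ k ∈ Finset.range i, mapChain R shiftLabel ^ k)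
      (signPart R (-(i : ZMod p)) f), ?_, ?_⟩
    · refine Submodule.neg_mem _ (Submodule.sum_mem _ fun i _ => ?_)
      rw [LinearMap.sum_apply]
      exact Submodule.sum_mem _ fun k _ => hpow k _ (signPart_mem_supported _ hf)
    · have h1 : ∑ i ∈ Finset.range p,
          (mapChain R shiftLabel ^ i) (signPart R (-(i : ZMod p)) f) = 0 := by
        have := congrArg (signPart R 0) h0
        rw [LinearMap.sum_apply, map_sum, map_zero] at this
        rw [← this]
        refine Finset.sum_congr rfl fun i _ => ?_
        rw [← signPart_pow hs hf, neg_add_cancel]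
      have h2 : ∑ i ∈ Finset.range p, signPart R (-(i : ZMod p)) f = f := by
        rw [sum_range_cast_zmod (fun z : ZMod p => signPart R (-z) f)]
        conv_rhs => rw [← sum_signPart f]
        exact Equiv.sum_comp (Equiv.neg (ZMod p)) (fun z => signPart R z f)
      rw [map_neg, map_sum]
      conv_lhs => rw [← h2, ← sub_zero (∑ i ∈ Finset.range p, _), ← h1,
        ← Finset.sum_sub_distrib]
      rw [← Finset.sum_neg_distrib]
      refine Finset.sum_congr rfl fun i _ => ?_
      have h := LinearMap.congr_fun (mul_geom_sum
        (R := Module.End R (List (ZMod p × ℕ) →₀ R)) (mapChain R shiftLabel) i)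
        (signPart R (-(i : ZMod p)) f)
      refine Eq.trans ?_ (congrArg Neg.neg h.symm)
      simp

end CyclicExactness

section Degenerate

variable {R : Type*} [CommRing R] {α : Type*}

/-- The lists with two equal consecutive entries. -/
def degenerateLists (α : Type*) : Set (List α) := {l | ¬ l.IsChain (· ≠ ·)}

lemma cons_mem_degenerateLists (a : α) {l : List α} (hl : l ∈ degenerateLists α) :
    a :: l ∈ degenerateLists α := fun h => hl h.tail

lemma consChain_mem_supported {s t : Set (List α)} (a : α) (h : ∀ l ∈ s, a :: l ∈ t)
    {f : List α →₀ R} (hf : f ∈ Finsupp.supported R R s) :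
    consChain R a f ∈ Finsupp.supported R R t :=
  mem_supported_of_single _ (fun l hl => by
    rw [consChain_single]; exact Finsupp.single_mem_supported R _ (h l hl)) hf

lemma boundary_mem_supported_degenerateLists {f : List α →₀ R}
    (hf : f ∈ Finsupp.supported R R (degenerateLists α)) :
    boundary R α f ∈ Finsupp.supported R R (degenerateLists α) := by
  refine mem_supported_of_single _ (fun l hl => ?_) hf
  induction l with
  | nil => exact absurd List.isChain_nil hl
  | cons a l ih =>
    by_cases hl' : l ∈ degenerateLists α
    · rw [boundary_single_cons]
      exact Submodule.sub_mem _ (Finsupp.single_mem_supported R _ hl')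
        (consChain_mem_supported a (fun l hl => cons_mem_degenerateLists a hl) (ih hl'))
    · cases l with
      | nil => exact absurd (List.isChain_singleton a) hl
      | cons b l =>
        have hab : a = b := by
          by_contra hab
          simp only [degenerateLists, Set.mem_ofPred_eq, not_not] at hl hl'
          exact hl (List.isChain_cons_cons.2 ⟨hab, hl'⟩)
        subst hab
        rw [boundary_single_cons, boundary_single_cons, map_sub, consChain_single,
          sub_sub_cancel]
        have : boundary R α (Finsupp.single l 1) ∈ Finsupp.supported R R Set.univ := by simp
        have h2 := consChain_mem_supported a (t := {l | ∃ l', l = a :: l'})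
          (fun l _ => ⟨l, rfl⟩) this
        refine consChain_mem_supported a ?_ h2
        rintro _ ⟨l', rfl⟩
        simp [degenerateLists, List.isChain_cons_cons]

lemma boundary_mem_supported_length {d : ℕ} {f : List α →₀ R}
    (hf : f ∈ Finsupp.supported R R {l : List α | l.length = d + 1}) :
    boundary R α f ∈ Finsupp.supported R R {l : List α | l.length = d} := by
  refine mem_supported_of_single _ (fun l hl => ?_) hf
  clear hf
  induction l generalizing d with
  | nil => simp at hl
  | cons a l ih =>
    rw [boundary_single_cons]
    have hl' : l.length = d := by simpa using hl
    refine Submodule.sub_mem _ (Finsupp.single_mem_supported R _ hl') ?_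
    cases l with
    | nil => simp
    | cons b l =>
      refine consChain_mem_supported a (s := {m | m.length = l.length}) ?_ (ih (by simp))
      intro m hm
      simp only [Set.mem_ofPred_eq, List.length_cons] at hm hl' ⊢
      omega

end Degenerate

section CyclicTucker

variable {p : ℕ}

lemma degenerate_map_shiftLabel (l : List (ZMod p × ℕ)) :
    l.map shiftLabel ∈ degenerateLists (ZMod p × ℕ) ↔ l ∈ degenerateLists (ZMod p × ℕ) := by
  have : ∀ a b : ZMod p × ℕ, shiftLabel a ≠ shiftLabel b ↔ a ≠ b := by
    intro a b
    simp [shiftLabel, Prod.ext_iff]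
  simp only [degenerateLists, Set.mem_ofPred_eq, List.isChain_map, this]

/-- A sequence of chains resolving the trivial module over the cyclic group cannot become
degenerate. -/
lemma not_degenerate_of_cyclic_resolution [Fact p.Prime]
    (f : ℕ → (List (ZMod p × ℕ) →₀ ZMod p))
    (hlen : ∀ j, f j ∈ Finsupp.supported (ZMod p) (ZMod p) {l | l.length = j + 1})
    (h0 : boundary (ZMod p) _ (f 0) = Finsupp.single [] 1)
    (hsucc : ∀ j, boundary (ZMod p) _ (f (j + 1)) = cyclicOp (ZMod p) p shiftLabel j (f j))
    (m : ℕ) (hm : f m ∈ Finsupp.supported (ZMod p) (ZMod p) (degenerateLists _)) : False := by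
  set P := fun j => cyclicOp (ZMod p) p (shiftLabel (p := p)) j with hP
  have hdeg : ∀ j, ∀ w ∈ Finsupp.supported (ZMod p) (ZMod p) (degenerateLists (ZMod p × ℕ)),
      P j w ∈ Finsupp.supported (ZMod p) (ZMod p) (degenerateLists (ZMod p × ℕ)) :=
    fun j w hw => cyclicOp_mem_supported _ _ _
      (fun l hl => (degenerate_map_shiftLabel l).2 hl) hw
  have key : ∀ j ≤ m, ∃ a b w, f j = boundary (ZMod p) _ a + P (j + 1) b + w ∧
      b ∈ Finsupp.supported (ZMod p) (ZMod p) {l | l.length = j + 1} ∧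
      w ∈ Finsupp.supported (ZMod p) (ZMod p) (degenerateLists _) := by
    intro j hj
    induction hj using Nat.decreasingInduction with
    | self => exact ⟨0, 0, f m, by simp, Submodule.zero_mem _, hm⟩
    | of_succ j _ ih =>
      obtain ⟨a, b, w, hf, hb, hw⟩ := ih
      have hP2 : P (j + 1 + 1) = P j := by
        simp [hP, cyclicOp, Nat.even_add_one]
      have h1 : P j (f j - boundary (ZMod p) _ b) = boundary (ZMod p) _ w := by
        have h2 := hsucc j
        rw [hf, map_add, map_add, boundary_boundary, zero_add, hP2] at h2
        simp only [hP] at h2 ⊢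
        rw [map_sub, ← h2, boundary_cyclicOp]
        abel
      have hx : f j - boundary (ZMod p) _ b ∈
          Finsupp.supported (ZMod p) (ZMod p) {l | l.length = j + 1} :=
        Submodule.sub_mem _ (hlen j) (boundary_mem_supported_length hb)
      set x := f j - boundary (ZMod p) _ b with hxdef
      classical
      set u := x.filter (fun l => l ∉ degenerateLists (ZMod p × ℕ)) with hu
      set w' := x.filter (fun l => ¬ l ∉ degenerateLists (ZMod p × ℕ)) with hw'
      have hxuw : u + w' = x := Finsupp.filter_add_filter_not x _
      set T : Set (List (ZMod p × ℕ)) :=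
        {l | l.length = j + 1 ∧ l ∉ degenerateLists (ZMod p × ℕ)} with hT
      have huT : u ∈ Finsupp.supported (ZMod p) (ZMod p) T := by
        rw [Finsupp.mem_supported]
        intro l hl
        rw [hu, Finsupp.support_filter] at hl
        simp only [Finset.coe_filter, Set.mem_ofPred_eq] at hl
        exact ⟨(Finsupp.mem_supported _ _).1 hx hl.1, hl.2⟩
      have hw'N : w' ∈ Finsupp.supported (ZMod p) (ZMod p) (degenerateLists (ZMod p × ℕ)) := by
        rw [Finsupp.mem_supported]
        intro l hl
        rw [hw', Finsupp.support_filter] at hl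
        simp only [Finset.coe_filter, Set.mem_ofPred_eq, not_not] at hl
        exact hl.2
      have hTinv : ∀ l ∈ T, l.map shiftLabel ∈ T := by
        rintro l ⟨h1, h2⟩
        exact ⟨by simpa using h1, fun h => h2 ((degenerate_map_shiftLabel l).1 h)⟩
      have hPu0 : P j u = 0 := by
        have ha : P j u ∈ Finsupp.supported (ZMod p) (ZMod p) T :=
          cyclicOp_mem_supported _ _ _ hTinv huT
        have hb' : P j u ∈ Finsupp.supported (ZMod p) (ZMod p) (degenerateLists _) := by
          have : P j u = boundary (ZMod p) _ w - P j w' := by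
            rw [← h1, ← hxuw, map_add]
            abel
          rw [this]
          exact Submodule.sub_mem _ (boundary_mem_supported_degenerateLists hw) (hdeg j _ hw'N)
        have hdisj : Disjoint T (degenerateLists (ZMod p × ℕ)) :=
          Set.disjoint_left.2 fun l hl hl' => hl.2 hl'
        exact (Submodule.disjoint_def.1
          ((Finsupp.disjoint_supported_supported (R := ZMod p) (M := ZMod p)) hdisj)) _ ha hb'
      obtain ⟨b', hb', hub'⟩ := exists_eq_cyclicOp_of_cyclicOp_eq_zero
        (by simp [hT]) hTinv huT j hPu0
      refine ⟨b, b', w', ?_, ?_, hw'N⟩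
      · simp only [hP]
        rw [← hub', add_assoc, hxuw, hxdef]
        abel
      · exact Finsupp.supported_mono (fun l hl => hl.1) hb'
  obtain ⟨a, b, w, hf, -, hw⟩ := key 0 (Nat.zero_le _)
  have h1 := h0
  rw [hf, map_add, map_add, boundary_boundary, zero_add] at h1
  simp only [hP] at h1
  rw [boundary_cyclicOp] at h1
  have h2 := congrArg (fun y => y []) h1
  have hpow : ∀ (i : ℕ) (y : List (ZMod p × ℕ) →₀ ZMod p),
      ((mapChain (ZMod p) shiftLabel ^ i) y) [] = y [] := by
    intro i y
    have : Finsupp.lapply [] ∘ₗ (mapChain (ZMod p) (shiftLabel (p := p)) ^ i) =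
        Finsupp.lapply (R := ZMod p) (M := ZMod p) [] := by
      ext l : 2
      cases l with
      | nil => simp [mapChain_pow]
      | cons a l => simp [mapChain_pow]
    exact LinearMap.congr_fun this y
  have hw0 : (boundary (ZMod p) _ w) [] = 0 := by
    by_contra h
    exact (Finsupp.mem_supported _ _).1 (boundary_mem_supported_degenerateLists hw)
      (Finsupp.mem_support_iff.2 h) List.isChain_nil
  simp [cyclicOp, LinearMap.sum_apply, hpow, hw0] at h2

end CyclicTucker

section SignedVectors

variable {p : ℕ}

/-- The nonzero vectors over `ℤ/p ∪ {0}`, with `none` in the role of `0`. -/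
abbrev SignedVector (p : ℕ) := {x : ℕ → Option (ZMod p) // ∃ a, x a ≠ none}

/-- `x` is obtained from `y` by setting some entries to zero. -/
def SignedVector.Below (x y : SignedVector p) : Prop := ∀ a, x.1 a = none ∨ x.1 a = y.1 a

/-- The cyclic shift of all signs. -/
def SignedVector.shift (x : SignedVector p) : SignedVector p :=
  ⟨fun a => (x.1 a).map (· + 1), by
    obtain ⟨a, ha⟩ := x.2
    exact ⟨a, by simpa using ha⟩⟩

/-- The vector whose entry at `j` is replaced by the sign `0`. -/
def SignedVector.insert (j : ℕ) (x : SignedVector p) : SignedVector p :=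
  ⟨Function.update x.1 j (some 0), j, by simp⟩

/-- The vector with sign `0` at `j` and no other nonzero entry. -/
def SignedVector.unit (p j : ℕ) : SignedVector p :=
  ⟨Function.update (fun _ => none) j (some 0), j, by simp⟩

/-- All nonzero entries have index less than `n`. -/
def SignedVector.SupportedBelow (n : ℕ) (x : SignedVector p) : Prop := ∀ a, n ≤ a → x.1 a = none

namespace SignedVector

lemma Below.trans {x y z : SignedVector p} (h : x.Below y) (h' : y.Below z) : x.Below z := by
  intro a
  rcases h a with h1 | h1
  · exact Or.inl h1
  · rw [h1]
    exact h' a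

lemma Below.shift {x y : SignedVector p} (h : x.Below y) : x.shift.Below y.shift := by
  intro a
  rcases h a with h1 | h1 <;> simp [SignedVector.shift, h1]

lemma Below.insert {x y : SignedVector p} (h : x.Below y) (j : ℕ) :
    (x.insert j).Below (y.insert j) := by
  intro a
  by_cases ha : a = j
  · subst ha
    simp [SignedVector.insert]
  · simpa [SignedVector.insert, ha] using h a

lemma SupportedBelow.below_insert {j : ℕ} {x : SignedVector p} (h : x.SupportedBelow j) :
    x.Below (x.insert j) := by
  intro a
  by_cases ha : a = j
  · subst ha
    exact Or.inl (h a le_rfl)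
  · simp [SignedVector.insert, ha]

lemma unit_below_insert (j : ℕ) (x : SignedVector p) : (unit p j).Below (x.insert j) := by
  intro a
  by_cases ha : a = j
  · subst ha
    simp [SignedVector.insert, unit]
  · simp [unit, ha]

lemma SupportedBelow.mono {m n : ℕ} (hmn : m ≤ n) {x : SignedVector p} (h : x.SupportedBelow m) :
    x.SupportedBelow n := fun a ha => h a (hmn.trans ha)

lemma SupportedBelow.shift {n : ℕ} {x : SignedVector p} (h : x.SupportedBelow n) :
    x.shift.SupportedBelow n := fun a ha => by simp [SignedVector.shift, h a ha]

lemma SupportedBelow.insert {j : ℕ} {x : SignedVector p} (h : x.SupportedBelow j) :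
    (x.insert j).SupportedBelow (j + 1) := by
  intro a ha
  have : a ≠ j := by omega
  simpa [SignedVector.insert, this] using h a (by omega)

lemma unit_supportedBelow (j : ℕ) : (unit p j).SupportedBelow (j + 1) := by
  intro a ha
  have : a ≠ j := by omega
  simp [unit, this]

lemma iterate_shift (i : ℕ) (x : SignedVector p) (a : ℕ) :
    (shift^[i] x).1 a = (x.1 a).map (· + (i : ZMod p)) := by
  induction i with
  | zero => simp
  | succ i ih =>
    rw [Function.iterate_succ_apply']
    simp only [shift, ih, Option.map_map]
    congr 1
    funext z
    simp [add_assoc]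

lemma iterate_shift_self : shift^[p] = (id : SignedVector p → SignedVector p) := by
  funext x
  refine Subtype.ext (funext fun a => ?_)
  rw [iterate_shift]
  simp

/-- The flags of length `d` of signed vectors supported below `n`. -/
def flags (p n d : ℕ) : Set (List (SignedVector p)) :=
  {l | l.length = d ∧ l.Pairwise Below ∧ ∀ x ∈ l, x.SupportedBelow n}

lemma map_shift_mem_flags {n d : ℕ} {l : List (SignedVector p)} (hl : l ∈ flags p n d) :
    l.map shift ∈ flags p n d := by
  obtain ⟨h1, h2, h3⟩ := hl
  refine ⟨by simpa using h1, ?_, ?_⟩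
  · rw [List.pairwise_map]
    exact h2.imp Below.shift
  · intro x hx
    obtain ⟨y, hy, rfl⟩ := List.mem_map.1 hx
    exact (h3 y hy).shift

variable {R : Type*} [CommRing R]

lemma prism_mem_supported {j : ℕ} {l : List (SignedVector p)} (hl : l.Pairwise Below)
    (hsupp : ∀ x ∈ l, x.SupportedBelow j) :
    prism R (insert j) (Finsupp.single l 1) ∈ Finsupp.supported R R
      {m | m.length = l.length + 1 ∧ m.Pairwise Below ∧
        ∀ z ∈ m, ∃ y ∈ l, z = y ∨ z = y.insert j} := by
  induction l with
  | nil => simp [prism, listPrism]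
  | cons x l ih =>
    rw [List.pairwise_cons] at hl
    have hx := hsupp x List.mem_cons_self
    have hxl : ∀ y ∈ l, x.Below y ∧ x.Below (y.insert j) := fun y hy =>
      ⟨hl.1 y hy, (hl.1 y hy).trans
        (hsupp y (List.mem_cons_of_mem _ hy)).below_insert⟩
    rw [prism_single_cons]
    refine Submodule.sub_mem _ (Finsupp.single_mem_supported R _ ⟨by simp, ?_, ?_⟩) ?_
    · rw [List.pairwise_cons, List.pairwise_cons, List.pairwise_map]
      refine ⟨?_, ?_, hl.2.imp fun h => h.insert j⟩
      · intro y hy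
        rcases List.mem_cons.1 hy with rfl | hy
        · exact hx.below_insert
        · obtain ⟨z, hz, rfl⟩ := List.mem_map.1 hy
          exact (hxl z hz).2
      · intro y hy
        obtain ⟨z, hz, rfl⟩ := List.mem_map.1 hy
        exact (hl.1 z hz).insert j
    · intro z hz
      rcases List.mem_cons.1 hz with rfl | hz
      · exact ⟨z, List.mem_cons_self, Or.inl rfl⟩
      · rw [← List.map_cons] at hz
        obtain ⟨y, hy, rfl⟩ := List.mem_map.1 hz
        exact ⟨y, hy, Or.inr rfl⟩
    · refine consChain_mem_supported x ?_
        (ih hl.2 fun y hy => hsupp y (List.mem_cons_of_mem _ hy))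
      rintro m ⟨h1, h2, h3⟩
      refine ⟨by simp [h1], ?_, ?_⟩
      · rw [List.pairwise_cons]
        refine ⟨fun z hz => ?_, h2⟩
        obtain ⟨y, hy, rfl | rfl⟩ := h3 z hz
        · exact (hxl _ hy).1
        · exact (hxl y hy).2
      · intro z hz
        rcases List.mem_cons.1 hz with rfl | hz
        · exact ⟨z, List.mem_cons_self, Or.inl rfl⟩
        · obtain ⟨y, hy, h⟩ := h3 z hz
          exact ⟨y, List.mem_cons_of_mem _ hy, h⟩

lemma contraction_mem_supported {j d : ℕ} {f : List (SignedVector p) →₀ R}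
    (hf : f ∈ Finsupp.supported R R (flags p j d)) :
    contraction R (unit p j) (insert j) f ∈ Finsupp.supported R R (flags p (j + 1) (d + 1)) := by
  refine mem_supported_of_single _ ?_ hf
  rintro l ⟨h1, h2, h3⟩
  simp only [contraction, LinearMap.sub_apply, LinearMap.comp_apply, mapChain_single,
    consChain_single]
  refine Submodule.sub_mem _ (Finsupp.single_mem_supported R _ ⟨by simp [h1], ?_, ?_⟩) ?_
  · rw [List.pairwise_cons, List.pairwise_map]
    refine ⟨fun z hz => ?_, h2.imp fun h => h.insert j⟩
    obtain ⟨y, hy, rfl⟩ := List.mem_map.1 hz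
    exact unit_below_insert j y
  · intro z hz
    rcases List.mem_cons.1 hz with rfl | hz
    · exact unit_supportedBelow j
    · obtain ⟨y, hy, rfl⟩ := List.mem_map.1 hz
      exact (h3 y hy).insert
  · refine Finsupp.supported_mono ?_ (prism_mem_supported h2 h3)
    rintro m ⟨k1, k2, k3⟩
    refine ⟨by rw [k1, h1], k2, fun z hz => ?_⟩
    obtain ⟨y, hy, rfl | rfl⟩ := k3 z hz
    · exact (h3 _ hy).mono (Nat.le_succ j)
    · exact (h3 y hy).insert

/-- A chain-level resolution of the trivial module by flags of signed vectors. -/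
noncomputable def resolution (p : ℕ) : ℕ → (List (SignedVector p) →₀ ZMod p)
  | 0 => Finsupp.single [unit p 0] 1
  | j + 1 => contraction (ZMod p) (unit p (j + 1)) (insert (j + 1))
      (cyclicOp (ZMod p) p shift j (resolution p j))

lemma resolution_mem_supported (j : ℕ) :
    resolution p j ∈ Finsupp.supported (ZMod p) (ZMod p) (flags p (j + 1) (j + 1)) := by
  induction j with
  | zero =>
    refine Finsupp.single_mem_supported _ _ ⟨by simp, by simp, ?_⟩
    intro x hx
    rw [List.mem_singleton.1 hx]
    exact unit_supportedBelow 0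
  | succ j ih =>
    exact contraction_mem_supported
      (cyclicOp_mem_supported _ _ _ (fun l hl => map_shift_mem_flags hl) ih)

lemma boundary_resolution_zero :
    boundary (ZMod p) _ (resolution p 0) = Finsupp.single [] 1 := by
  simp [resolution, boundary_single_cons]

lemma boundary_resolution_succ (j : ℕ) :
    boundary (ZMod p) _ (resolution p (j + 1)) =
      cyclicOp (ZMod p) p shift j (resolution p j) := by
  have h0 : boundary (ZMod p) _ (cyclicOp (ZMod p) p shift j (resolution p j)) = 0 := by
    rw [boundary_cyclicOp]
    cases j with
    | zero => simp [boundary_resolution_zero, cyclicOp]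
    | succ j =>
      rw [boundary_resolution_succ j, ← Module.End.mul_apply,
        cyclicOp_succ_mul p shift iterate_shift_self, LinearMap.zero_apply]
  rw [resolution, boundary_contraction, h0, map_zero, sub_zero]

/-- A cyclic Tucker lemma: there is no equivariant labelling of the signed vectors of length `n`
by fewer than `n` ranks, monotone in the rank, in which comparable vectors of equal rank have equal
signs. -/
theorem cyclic_tucker [Fact p.Prime] (n : ℕ) (sign : SignedVector p → ZMod p)
    (rank : SignedVector p → ℕ) (hsign : ∀ x, sign x.shift = sign x + 1)
    (hrank : ∀ x, rank x.shift = rank x) (hpos : ∀ x, x.SupportedBelow n → 1 ≤ rank x)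
    (hlt : ∀ x, x.SupportedBelow n → rank x < n)
    (hmono : ∀ x y, x.Below y → x.SupportedBelow n → y.SupportedBelow n → rank x ≤ rank y)
    (heq : ∀ x y, x.Below y → x.SupportedBelow n → y.SupportedBelow n → rank x = rank y →
      sign x = sign y) : n = 0 := by
  rcases n with _ | m
  · rfl
  exfalso
  set φ : SignedVector p → ZMod p × ℕ := fun x => (sign x, rank x) with hφ
  have hmap : ∀ {s : Set (List (SignedVector p))} {t : Set (List (ZMod p × ℕ))}
      {f : List (SignedVector p) →₀ ZMod p}, (∀ l ∈ s, l.map φ ∈ t) →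
      f ∈ Finsupp.supported (ZMod p) (ZMod p) s →
      mapChain (ZMod p) φ f ∈ Finsupp.supported (ZMod p) (ZMod p) t := by
    intro s t f h hf
    refine mem_supported_of_single _ (fun l hl => ?_) hf
    rw [mapChain_single]
    exact Finsupp.single_mem_supported _ _ (h l hl)
  refine not_degenerate_of_cyclic_resolution (fun j => mapChain (ZMod p) φ (resolution p j))
    (fun j => hmap ?_ (resolution_mem_supported j)) ?_ (fun j => ?_) m
    (hmap ?_ (resolution_mem_supported m))
  · rintro l ⟨h1, -, -⟩
    simpa using h1
  · rw [boundary_mapChain, boundary_resolution_zero, mapChain_single, List.map_nil]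
  · rw [boundary_mapChain, boundary_resolution_succ]
    exact mapChain_cyclicOp p φ shift shiftLabel (fun x => by simp [hφ, shiftLabel, hsign, hrank])
      j _
  · rintro l ⟨h1, h2, h3⟩ hchain
    rw [List.isChain_map] at hchain
    have hlt' : l.Pairwise (fun x y => rank x < rank y) := by
      have h5 : l.IsChain (fun x y => rank x < rank y) := by
        have h4 : l.IsChain (fun x y => (x.Below y ∧ φ x ≠ φ y) ∧
            x.SupportedBelow (m + 1) ∧ y.SupportedBelow (m + 1)) := by
          clear h1
          induction l with
          | nil => exact List.isChain_nil
          | cons x l ih =>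
            cases l with
            | nil => exact List.isChain_singleton x
            | cons y l =>
              rw [List.isChain_cons_cons] at hchain ⊢
              rw [List.pairwise_cons] at h2
              exact ⟨⟨⟨h2.1 y List.mem_cons_self, hchain.1⟩, h3 x (by simp), h3 y (by simp)⟩,
                ih h2.2 (fun z hz => h3 z (List.mem_cons_of_mem _ hz)) hchain.2⟩
        refine h4.imp ?_
        rintro x y ⟨⟨hxy, hne⟩, hx, hy⟩
        refine lt_of_le_of_ne (hmono x y hxy hx hy) fun he => hne ?_
        exact Prod.ext (heq x y hxy hx hy he) he
      have : IsTrans (SignedVector p) (fun x y => rank x < rank y) := ⟨fun _ _ _ => lt_trans⟩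
      exact List.isChain_iff_pairwise.1 h5
    have hnodup : (l.map rank).Nodup := by
      rw [List.Nodup, List.pairwise_map]
      exact hlt'.imp fun h => h.ne
    have hcard := Finset.card_le_card (s := (l.map rank).toFinset) (t := Finset.Icc 1 m) (by
      intro z hz
      obtain ⟨x, hx, rfl⟩ := List.mem_map.1 (List.mem_toFinset.1 hz)
      exact Finset.mem_Icc.2 ⟨hpos x (h3 x hx), Nat.lt_succ_iff.1 (hlt x (h3 x hx))⟩)
    rw [List.toFinset_card_of_nodup hnodup] at hcard
    simp [h1] at hcard

end SignedVector

end SignedVectors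

section Packing

/-- `X` contains `k` pairwise disjoint `r`-sets with property `Q`. -/
def HasPacking (X : Finset ℕ) (r k : ℕ) (Q : Finset ℕ → Prop) : Prop :=
  ∃ F : Finset (Finset ℕ), F.card = k ∧ (F : Set (Finset ℕ)).Pairwise Disjoint ∧
    ∀ A ∈ F, A ⊆ X ∧ A.card = r ∧ Q A

/-- The mean of a set of residues, meaningful for proper nonempty subsets. -/
noncomputable def residueMean {p : ℕ} (S : Finset (ZMod p)) : ZMod p :=
  (∑ z ∈ S, z) * (S.card : ZMod p)⁻¹

lemma residueMean_shift {p : ℕ} [Fact p.Prime] {S S' : Finset (ZMod p)} (hS : S.Nonempty)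
    (hS' : S.card < p) (h : S' = S.map (Equiv.addRight 1).toEmbedding) :
    residueMean S' = residueMean S + 1 := by
  have hne : (S.card : ZMod p) ≠ 0 := by
    rw [Ne, ZMod.natCast_eq_zero_iff]
    exact Nat.not_dvd_of_pos_of_lt hS.card_pos hS'
  subst h
  simp only [residueMean, Finset.card_map, Finset.sum_map, Equiv.coe_toEmbedding,
    Equiv.coe_addRight, Finset.sum_add_distrib, Finset.sum_const, nsmul_eq_mul, mul_one]
  rw [add_mul, mul_inv_cancel₀ hne]

open Classical in
theorem hasPacking_of_prime {p : ℕ} [Fact p.Prime] {r t : ℕ} (hr : 1 ≤ r) (V : Finset ℕ)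
    (hV : p * (r - 1) + t * (p - 1) < V.card) (c : Finset ℕ → Fin t) :
    ∃ i, HasPacking V r p (fun A => c A = i) := by
  by_contra! hno
  set n := V.card with hn
  obtain ⟨e, he_mem, he_inj⟩ : ∃ e : ℕ → ℕ, (∀ a < n, e a ∈ V) ∧
      Set.InjOn e {a | a < n} := by
    refine ⟨fun a => if h : a < n then V.orderEmbOfFin hn.symm ⟨a, h⟩ else 0, ?_, ?_⟩
    · intro a ha
      simp [ha, Finset.orderEmbOfFin_mem]
    · intro a (ha : a < n) b (hb : b < n) hab
      simpa [ha, hb] using hab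
  set part : SignedVector p → ZMod p → Finset ℕ := fun x z =>
    ((Finset.range n).filter fun a => x.1 a = some z).image e with hpart
  have hpart_shift : ∀ x z, part x.shift z = part x (z - 1) := by
    intro x z
    simp only [hpart, SignedVector.shift]
    congr 1
    refine Finset.filter_congr fun a _ => ?_
    cases x.1 a with
    | none => simp
    | some w => simp [eq_sub_iff_add_eq]
  have hpart_mono : ∀ x y : SignedVector p, x.Below y → ∀ z, part x z ⊆ part y z := by
    intro x y hxy z
    refine Finset.image_subset_image fun a ha => ?_
    rw [Finset.mem_filter] at ha ⊢
    refine ⟨ha.1, ?_⟩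
    rcases hxy a with h | h
    · simp [h] at ha
    · rw [← h, ha.2]
  have hpart_sub : ∀ x z, part x z ⊆ V := by
    intro x z b hb
    obtain ⟨a, ha, rfl⟩ := Finset.mem_image.1 hb
    exact he_mem a (by simpa using (Finset.mem_filter.1 ha).1)
  have hpart_disj : ∀ x z w, z ≠ w → Disjoint (part x z) (part x w) := by
    intro x z w hzw
    rw [Finset.disjoint_left]
    intro b hb hb'
    obtain ⟨a, ha, rfl⟩ := Finset.mem_image.1 hb
    obtain ⟨a', ha', haa⟩ := Finset.mem_image.1 hb'
    rw [Finset.mem_filter, Finset.mem_range] at ha ha'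
    have := he_inj ha'.1 ha.1 haa
    subst this
    exact hzw (Option.some.inj (ha.2.symm.trans ha'.2))
  have hpart_card : ∀ x z, (part x z).card =
      ((Finset.range n).filter fun a => x.1 a = some z).card := by
    intro x z
    refine Finset.card_image_of_injOn (he_inj.mono fun a ha => ?_)
    simp only [Finset.coe_filter, Finset.mem_range] at ha
    exact ha.1
  set T : SignedVector p → Fin t → Finset (ZMod p) := fun x i =>
    Finset.univ.filter fun z => ∃ A ⊆ part x z, A.card = r ∧ c A = i with hT
  have hT_shift : ∀ x i, T x.shift i = (T x i).map (Equiv.addRight 1).toEmbedding := by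
    intro x i
    ext z
    simp [hT, hpart_shift, sub_eq_add_neg]
  have hT_mono : ∀ x y : SignedVector p, x.Below y → ∀ i, T x i ⊆ T y i := by
    intro x y hxy i z hz
    simp only [hT, Finset.mem_filter, Finset.mem_univ, true_and] at hz ⊢
    obtain ⟨A, hA, h⟩ := hz
    exact ⟨A, hA.trans (hpart_mono x y hxy z), h⟩
  have hT_card : ∀ x i, (T x i).card < p := by
    intro x i
    by_contra! hcard
    have huniv : T x i = Finset.univ := by
      rw [← Finset.card_eq_iff_eq_univ, ZMod.card]
      exact le_antisymm (by simpa [ZMod.card] using Finset.card_le_univ (T x i)) hcard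
    have hall : ∀ z, ∃ A ⊆ part x z, A.card = r ∧ c A = i := by
      intro z
      have : z ∈ T x i := huniv ▸ Finset.mem_univ z
      simpa [hT] using this
    choose A hA hAr hAc using hall
    have hdisj : ∀ z w, z ≠ w → Disjoint (A z) (A w) := fun z w hzw =>
      (hpart_disj x z w hzw).mono (hA z) (hA w)
    have hinj : Function.Injective A := by
      intro z w hzw
      by_contra hne
      have := hdisj z w hne
      rw [← hzw, disjoint_self, Finset.bot_eq_empty] at this
      have h2 := hAr z
      rw [this] at h2
      simp at h2
      omega
    refine hno i ⟨Finset.univ.image A, ?_, ?_, ?_⟩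
    · rw [Finset.card_image_of_injective _ hinj, Finset.card_univ, ZMod.card]
    · intro B hB B' hB' hne
      obtain ⟨z, -, rfl⟩ := Finset.mem_image.1 hB
      obtain ⟨w, -, rfl⟩ := Finset.mem_image.1 hB'
      exact hdisj z w fun h => hne (by rw [h])
    · intro B hB
      obtain ⟨z, -, rfl⟩ := Finset.mem_image.1 hB
      exact ⟨(hA z).trans (hpart_sub x z), hAr z, hAc z⟩
  set C : SignedVector p → Finset (Fin t) := fun x =>
    Finset.univ.filter fun i => (T x i).Nonempty with hC
  have hC_shift : ∀ x, C x.shift = C x := by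
    intro x
    simp [hC, hT_shift]
  have hC_mono : ∀ x y : SignedVector p, x.Below y → C x ⊆ C y := by
    intro x y hxy i hi
    simp only [hC, Finset.mem_filter, Finset.mem_univ, true_and] at hi ⊢
    exact hi.mono (hT_mono x y hxy i)
  set size : SignedVector p → ℕ := fun x =>
    ((Finset.range n).filter fun a => x.1 a ≠ none).card with hsize
  have hsize_small : ∀ x, C x = ∅ → size x ≤ p * (r - 1) := by
    intro x hx
    have hlt : ∀ z, (part x z).card ≤ r - 1 := by
      intro z
      by_contra! hlt
      obtain ⟨A, hA, hAr⟩ := Finset.exists_subset_card_eq (show r ≤ (part x z).card by omega)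
      have : c A ∈ C x := by
        simp only [hC, Finset.mem_filter, Finset.mem_univ, true_and]
        exact ⟨z, by simpa [hT] using ⟨A, hA, hAr, rfl⟩⟩
      simp [hx] at this
    have hsub : ((Finset.range n).filter fun a => x.1 a ≠ none) ⊆
        Finset.univ.biUnion fun z : ZMod p =>
          (Finset.range n).filter fun a => x.1 a = some z := by
      intro a ha
      rw [Finset.mem_filter] at ha
      obtain ⟨z, hz⟩ := Option.ne_none_iff_exists'.1 ha.2
      simp only [Finset.mem_biUnion, Finset.mem_filter, Finset.mem_univ, true_and]
      exact ⟨z, ha.1, hz⟩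
    calc size x ≤ _ := Finset.card_le_card hsub
      _ ≤ ∑ z : ZMod p, (part x z).card := by
        refine Finset.card_biUnion_le.trans (le_of_eq ?_)
        exact Finset.sum_congr rfl fun z _ => (hpart_card x z).symm
      _ ≤ ∑ _z : ZMod p, (r - 1) := Finset.sum_le_sum fun z _ => hlt z
      _ = p * (r - 1) := by simp [ZMod.card]
  have : Nonempty (Fin t) := ⟨c ∅⟩
  obtain ⟨color, hcolor⟩ : ∃ f : Finset (Fin t) → Fin t, ∀ S, S.Nonempty → f S ∈ S :=
    ⟨fun S => if h : S.Nonempty then h.choose else c ∅, fun S h => by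
      simpa [h] using h.choose_spec⟩
  obtain ⟨index, hindex⟩ : ∃ f : Set ℕ → ℕ, ∀ S, S.Nonempty → f S ∈ S :=
    ⟨fun S => if h : S.Nonempty then h.choose else 0, fun S h => by
      simpa [h] using h.choose_spec⟩
  have hTcol : ∀ x, C x ≠ ∅ → (T x (color (C x))).Nonempty := by
    intro x hx
    have := hcolor (C x) (Finset.nonempty_iff_ne_empty.2 hx)
    simp only [hC, Finset.mem_filter, Finset.mem_univ, true_and] at this
    exact this
  set rank : SignedVector p → ℕ := fun x =>
    if C x = ∅ then size x else p * (r - 1) + ∑ i, (T x i).card with hrankdef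
  set sign : SignedVector p → ZMod p := fun x =>
    if C x = ∅ then (x.1 (index {a | x.1 a ≠ none})).getD 0
    else residueMean (T x (color (C x))) with hsigndef
  have hsum_pos : ∀ x, C x ≠ ∅ → 1 ≤ ∑ i, (T x i).card := by
    intro x hx
    exact (hTcol x hx).card_pos.trans_le
      (Finset.single_le_sum (f := fun i => (T x i).card) (fun _ _ => Nat.zero_le _)
        (Finset.mem_univ _))
  have hn0 : n = 0 := by
    refine SignedVector.cyclic_tucker n sign rank ?_ ?_ ?_ ?_ ?_ ?_
    · intro x
      simp only [hsigndef, hC_shift]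
      split_ifs with hx
      · have hset : {a | x.shift.1 a ≠ none} = {a | x.1 a ≠ none} := by
          ext a
          simp [SignedVector.shift]
        rw [hset]
        have h1 := hindex {a | x.1 a ≠ none} x.2
        obtain ⟨z, hz⟩ := Option.ne_none_iff_exists'.1 h1
        simp [SignedVector.shift, hz]
      · exact residueMean_shift (hTcol x hx) (hT_card _ _) (hT_shift _ _)
    · intro x
      simp only [hrankdef, hC_shift, hT_shift, Finset.card_map]
      simp only [hsize, SignedVector.shift, ne_eq, Option.map_eq_none_iff]
    · intro x hx
      simp only [hrankdef]
      split_ifs with h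
      · obtain ⟨a, ha⟩ := x.2
        refine Finset.card_pos.2 ⟨a, ?_⟩
        rw [Finset.mem_filter, Finset.mem_range]
        refine ⟨?_, ha⟩
        by_contra! h'
        exact ha (hx a h')
      · have := hsum_pos x h
        omega
    · intro x _
      simp only [hrankdef]
      split_ifs with h
      · have := hsize_small x h
        omega
      · refine lt_of_le_of_lt (Nat.add_le_add_left ?_ _) hV
        calc ∑ i, (T x i).card ≤ ∑ _i : Fin t, (p - 1) :=
              Finset.sum_le_sum fun i _ => Nat.le_sub_one_of_lt (hT_card x i)
          _ = t * (p - 1) := by simp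
    · intro x y hxy _ _
      have hCm := hC_mono x y hxy
      simp only [hrankdef]
      split_ifs with h1 h2 h2
      · refine Finset.card_le_card fun a ha => ?_
        rw [Finset.mem_filter] at ha ⊢
        refine ⟨ha.1, ?_⟩
        rcases hxy a with h | h
        · exact absurd h ha.2
        · rw [← h]
          exact ha.2
      · have := hsize_small x h1
        omega
      · rw [h2, Finset.subset_empty] at hCm
        exact absurd hCm h1
      · exact Nat.add_le_add_left
          (Finset.sum_le_sum fun i _ => Finset.card_le_card (hT_mono x y hxy i)) _
    · intro x y hxy hx hy heq
      have hCm := hC_mono x y hxy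
      simp only [hrankdef] at heq
      split_ifs at heq with h1 h2 h2
      · have hxy' : x = y := by
          have hsub : ((Finset.range n).filter fun a => x.1 a ≠ none) ⊆
              ((Finset.range n).filter fun a => y.1 a ≠ none) := by
            intro a ha
            rw [Finset.mem_filter] at ha ⊢
            refine ⟨ha.1, ?_⟩
            rcases hxy a with h | h
            · exact absurd h ha.2
            · rw [← h]
              exact ha.2
          have hset := Finset.eq_of_subset_of_card_le hsub heq.ge
          refine Subtype.ext (funext fun a => ?_)
          rcases hxy a with h | h
          · by_cases ha : n ≤ a
            · rw [h, hy a ha]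
            · have h3 : a ∉ ((Finset.range n).filter fun a => y.1 a ≠ none) := by
                rw [← hset]
                simp [h]
              simp only [Finset.mem_filter, Finset.mem_range, not_and, not_not] at h3
              rw [h, h3 (by omega)]
          · exact h
        rw [hxy']
      · have := hsize_small x h1
        have := hsum_pos y h2
        omega
      · rw [h2, Finset.subset_empty] at hCm
        exact absurd hCm h1
      · have hsum : ∑ i, (T x i).card = ∑ i, (T y i).card := by omega
        have hall : T x = T y := by
          funext i
          have h3 := (Finset.sum_eq_sum_iff_of_le
            (fun i _ => Finset.card_le_card (hT_mono x y hxy i))).1 hsum i (Finset.mem_univ i)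
          exact Finset.eq_of_subset_of_card_le (hT_mono x y hxy i) h3.ge
        have hCC : C x = C y := by simp only [hC, hall]
        simp only [hsigndef, h2, if_false, hall, hCC]
  omega

open Classical in
/-- The Alon–Frankl–Lovász theorem with equal parameters. -/
theorem hasPacking_of_coloring {t : ℕ} (k : ℕ) : 1 ≤ k → ∀ (r : ℕ), 1 ≤ r →
    ∀ V : Finset ℕ, k * (r - 1) + t * (k - 1) < V.card → ∀ c : Finset ℕ → Fin t,
      ∃ i, HasPacking V r k (fun A => c A = i) := by
  induction k using Nat.recOnMul with
  | zero => intro h; omega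
  | one =>
    intro _ r hr V hV c
    obtain ⟨A, hA, hAr⟩ := Finset.exists_subset_card_eq (show r ≤ V.card by omega)
    exact ⟨c A, {A}, by simp, by simp, by simpa using ⟨hA, hAr⟩⟩
  | prime p hp =>
    intro _ r hr V hV c
    have : Fact p.Prime := ⟨hp⟩
    exact hasPacking_of_prime hr V hV c
  | mul a b iha ihb =>
    intro hab r hr V hV c
    have ha : 1 ≤ a := Nat.pos_of_ne_zero fun h => by simp [h] at hab
    have hb : 1 ≤ b := Nat.pos_of_ne_zero fun h => by simp [h] at hab
    set q := a * (r - 1) + t * (a - 1) with hq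
    have hbig : ∀ B : Finset ℕ, ∃ i, B.card = q + 1 → HasPacking B r a (fun A => c A = i) := by
      intro B
      by_cases hB : B.card = q + 1
      · obtain ⟨i, hi⟩ := iha ha r hr B (by omega) c
        exact ⟨i, fun _ => hi⟩
      · exact ⟨c B, fun h => absurd h hB⟩
    choose c' hc' using hbig
    obtain ⟨i, G, hGb, hGd, hG⟩ := ihb hb (q + 1) (by omega) V (by
      refine lt_of_eq_of_lt ?_ hV
      obtain ⟨a, rfl⟩ := Nat.exists_eq_add_of_le' ha
      obtain ⟨b, rfl⟩ := Nat.exists_eq_add_of_le' hb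
      have : (a + 1) * (b + 1) - 1 = a * b + a + b := by
        rw [show (a + 1) * (b + 1) = a * b + a + b + 1 by ring]
        simp
      rw [this, hq]
      simp only [Nat.add_sub_cancel]
      ring) c'
    have hpack : ∀ B : Finset ℕ, ∃ F : Finset (Finset ℕ), B ∈ G → F.card = a ∧
        (F : Set (Finset ℕ)).Pairwise Disjoint ∧ ∀ A ∈ F, A ⊆ B ∧ A.card = r ∧ c A = i := by
      intro B
      by_cases hB : B ∈ G
      · obtain ⟨-, h1, h2⟩ := hG B hB
        obtain ⟨F, hF⟩ := hc' B h1
        rw [h2] at hF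
        exact ⟨F, fun _ => hF⟩
      · exact ⟨∅, fun h => absurd h hB⟩
    choose F hF using hpack
    have hcross : ∀ B ∈ G, ∀ B' ∈ G, B ≠ B' → ∀ A ∈ F B, ∀ A' ∈ F B', Disjoint A A' :=
      fun B hB B' hB' hne A hA A' hA' =>
        (hGd hB hB' hne).mono ((hF B hB).2.2 A hA).1 ((hF B' hB').2.2 A' hA').1
    refine ⟨i, G.biUnion F, ?_, ?_, ?_⟩
    · rw [Finset.card_biUnion, Finset.sum_congr rfl fun B hB => (hF B hB).1]
      · simp [hGb, mul_comm]
      · intro B hB B' hB' hne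
        rw [Function.onFun, Finset.disjoint_left]
        intro A hA hA'
        have h1 := hcross B hB B' hB' hne A hA A hA'
        rw [disjoint_self, Finset.bot_eq_empty] at h1
        have h2 := ((hF B hB).2.2 A hA).2.1
        rw [h1, Finset.card_empty] at h2
        omega
    · intro A hA A' hA' hne
      obtain ⟨B, hB, hAB⟩ := Finset.mem_biUnion.1 hA
      obtain ⟨B', hB', hAB'⟩ := Finset.mem_biUnion.1 hA'
      by_cases hBB : B = B'
      · subst hBB
        exact (hF B hB).2.1 hAB hAB' hne
      · exact hcross B hB B' hB' hBB A hAB A' hAB'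
    · intro A hA
      obtain ⟨B, hB, hAB⟩ := Finset.mem_biUnion.1 hA
      obtain ⟨h1, h2⟩ := (hF B hB).2.2 A hAB
      exact ⟨h1.trans (hG B hB).1, h2⟩

end Packing

section Ramsey

lemma Set.Pairwise.insert_color {α : Type*} {c : α → α → Bool} (hc : ∀ u v, c u v = c v u)
    {S : Set α} {v : α} {b : Bool} (hS : S.Pairwise fun x y => c x y = b)
    (hv : ∀ x ∈ S, c v x = b) : (insert v S).Pairwise fun x y => c x y = b :=
  Set.pairwise_insert.2 ⟨hS, fun x hx _ => ⟨hv x hx, (hc x v).trans (hv x hx)⟩⟩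

/-- Finite Ramsey theorem for two colors. -/
theorem exists_forall_card_le_mono (s t : ℕ) :
    ∃ n : ℕ, ∀ c : ℕ → ℕ → Bool, (∀ u v, c u v = c v u) → ∀ F : Finset ℕ, n ≤ F.card →
      (∃ S ⊆ F, S.card = s ∧ (S : Set ℕ).Pairwise fun u v => c u v = true) ∨
      (∃ S ⊆ F, S.card = t ∧ (S : Set ℕ).Pairwise fun u v => c u v = false) := by
  induction s generalizing t with
  | zero => exact ⟨0, fun c _ F _ => Or.inl ⟨∅, by simp⟩⟩
  | succ s ihs =>
    induction t with
    | zero => exact ⟨0, fun c _ F _ => Or.inr ⟨∅, by simp⟩⟩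
    | succ t iht =>
      obtain ⟨n₁, h₁⟩ := ihs (t + 1)
      obtain ⟨n₂, h₂⟩ := iht
      refine ⟨n₁ + n₂ + 1, fun c hc F hF => ?_⟩
      obtain ⟨v, hv⟩ : F.Nonempty := Finset.card_pos.1 (by omega)
      have hcard := Finset.card_filter_add_card_filter_not (s := F.erase v) (fun u => c v u = true)
      rw [Finset.card_erase_of_mem hv] at hcard
      have hext : ∀ (b : Bool) (G S : Finset ℕ) (k : ℕ), G ⊆ F.erase v → (∀ u ∈ G, c v u = b) →
          S ⊆ G → S.card = k → (S : Set ℕ).Pairwise (fun x y => c x y = b) →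
          ∃ S ⊆ F, S.card = k + 1 ∧ (S : Set ℕ).Pairwise fun x y => c x y = b := by
        intro b G S k hG hGb hS hSk hSb
        refine ⟨insert v S, Finset.insert_subset hv ((hS.trans hG).trans (Finset.erase_subset _ _)),
          ?_, ?_⟩
        · rw [Finset.card_insert_of_notMem fun h => Finset.notMem_erase v F (hG (hS h)), hSk]
        · rw [Finset.coe_insert]
          exact hSb.insert_color hc fun x hx => hGb x (hS hx)
      by_cases hle : n₁ ≤ ((F.erase v).filter fun u => c v u = true).card
      · rcases h₁ c hc _ hle with ⟨S, hS, hk, hm⟩ | ⟨S, hS, hk, hm⟩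
        · exact Or.inl (hext true _ S s (Finset.filter_subset _ _) (by simp) hS hk hm)
        · exact Or.inr ⟨S, hS.trans ((Finset.filter_subset _ _).trans (Finset.erase_subset _ _)),
            hk, hm⟩
      · rcases h₂ c hc ((F.erase v).filter fun u => ¬c v u = true) (by omega) with
          ⟨S, hS, hk, hm⟩ | ⟨S, hS, hk, hm⟩
        · exact Or.inl ⟨S, hS.trans ((Finset.filter_subset _ _).trans (Finset.erase_subset _ _)),
            hk, hm⟩
        · exact Or.inr (hext false _ S t (Finset.filter_subset _ _) (by simp) hS hk hm)

lemma ramseyProp_ramseyNumber (s t : ℕ) : RamseyProp (ramseyNumber s t) s t := by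
  refine Nat.sInf_mem (s := {n | RamseyProp n s t}) ?_
  obtain ⟨n, hn⟩ := exists_forall_card_le_mono s t
  refine ⟨n, fun c hc => ?_⟩
  rcases hn c hc (Finset.range n) (by simp) with ⟨S, hS, hk, hm⟩ | ⟨S, hS, hk, hm⟩
  · exact Or.inl ⟨S, hS, hk, fun u hu v hv => hm hu hv⟩
  · exact Or.inr ⟨S, hS, hk, fun u hu v hv => hm hu hv⟩

lemma RamseyProp.symm {n s t : ℕ} (h : RamseyProp n s t) : RamseyProp n t s := by
  intro c hc
  simpa using (h (fun u v => !c u v) fun u v => by rw [hc]).symm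

lemma RamseyProp.exists_mono {α : Type*} {n s t : ℕ} (h : RamseyProp n s t)
    {c : α → α → Bool} (hc : ∀ u v, c u v = c v u) {F : Finset α} (hF : F.card = n) :
    (∃ S ⊆ F, S.card = s ∧ (S : Set α).Pairwise fun u v => c u v = true) ∨
    (∃ S ⊆ F, S.card = t ∧ (S : Set α).Pairwise fun u v => c u v = false) := by
  let e := F.equivFinOfCardEq hF
  let d : ℕ → ℕ → Bool := fun i j =>
    if h : i < n ∧ j < n then c (e.symm ⟨i, h.1⟩) (e.symm ⟨j, h.2⟩) else true
  have hd : ∀ i j : Fin n, d i j = c (e.symm i) (e.symm j) := fun i j => by simp [d]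
  have hdc : ∀ i j, d i j = d j i := fun i j => by
    simp only [d, and_comm (a := i < n), hc]
  have htransfer : ∀ (b : Bool) (S : Finset ℕ), S ⊆ Finset.range n →
      (∀ u ∈ S, ∀ v ∈ S, u ≠ v → d u v = b) →
      ∃ T ⊆ F, T.card = S.card ∧ (T : Set α).Pairwise fun u v => c u v = b := by
    intro b S hS hm
    have hlt : ∀ i ∈ S, i < n := fun i hi => Finset.mem_range.1 (hS hi)
    let f : Fin n ↪ α := ⟨fun i => e.symm i, fun i j hij => e.symm.injective (Subtype.ext hij)⟩
    refine ⟨(S.attachFin hlt).map f, ?_, by simp, ?_⟩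
    · intro x hx
      obtain ⟨i, -, rfl⟩ := Finset.mem_map.1 hx
      exact (e.symm i).2
    · intro x hx y hy hxy
      obtain ⟨i, hi, rfl⟩ := Finset.mem_map.1 hx
      obtain ⟨j, hj, rfl⟩ := Finset.mem_map.1 hy
      rw [Finset.mem_attachFin] at hi hj
      exact (hd i j).symm.trans (hm i hi j hj fun hij => hxy (by rw [Fin.ext hij]))
  rcases h d hdc with ⟨S, hS, hk, hm⟩ | ⟨S, hS, hk, hm⟩
  · exact Or.inl (hk ▸ htransfer true S hS hm)
  · exact Or.inr (hk ▸ htransfer false S hS hm)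

lemma ramseyNumber_pos {s t : ℕ} (hs : 0 < s) (ht : 0 < t) : 0 < ramseyNumber s t := by
  have h := ramseyProp_ramseyNumber s t
  by_contra h0
  rw [Nat.eq_zero_of_not_pos h0] at h
  rcases h (fun _ _ => true) (fun _ _ => rfl) with ⟨S, hS, hk, -⟩ | ⟨S, hS, hk, -⟩ <;>
  · have := Finset.card_le_card hS
    rw [Finset.card_range] at this
    omega

lemma ramseyNumber_mono_right {s t t' : ℕ} (h : t ≤ t') :
    ramseyNumber s t ≤ ramseyNumber s t' := by
  refine Nat.sInf_le fun c hc => ?_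
  rcases ramseyProp_ramseyNumber s t' c hc with hS | ⟨S, hS, hk, hm⟩
  · exact Or.inl hS
  · obtain ⟨T, hT, hTk⟩ := Finset.exists_subset_card_eq (h.trans_eq hk.symm)
    exact Or.inr ⟨T, hT.trans hS, hTk, fun u hu v hv => hm u (hT hu) v (hT hv)⟩

lemma le_ramseyNumber_right {s t : ℕ} (hs : 2 ≤ s) : t ≤ ramseyNumber s t := by
  rcases ramseyProp_ramseyNumber s t (fun _ _ => false) (fun _ _ => rfl) with
    ⟨S, -, hk, hm⟩ | ⟨S, hS, hk, -⟩
  · obtain ⟨u, hu, v, hv, huv⟩ := Finset.one_lt_card.1 (hk.symm ▸ hs : 1 < S.card)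
    exact absurd (hm u hu v hv huv) (by simp)
  · simpa [hk] using Finset.card_le_card hS

end Ramsey

section Kneser

lemma HasPacking.mono {X Y : Finset ℕ} {r k l : ℕ} {P Q : Finset ℕ → Prop}
    (h : HasPacking X r k P) (hl : l ≤ k)
    (hPQ : ∀ A ⊆ X, P A → A ⊆ Y ∧ Q A) : HasPacking Y r l Q := by
  obtain ⟨F, hk, hd, hF⟩ := h
  obtain ⟨G, hG, hGl⟩ := Finset.exists_subset_card_eq (hl.trans_eq hk.symm)
  refine ⟨G, hGl, hd.mono (Finset.coe_subset.2 hG), fun A hA => ?_⟩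
  obtain ⟨h₁, h₂, h₃⟩ := hF A (hG hA)
  exact ⟨(hPQ A h₁ h₃).1, h₂, (hPQ A h₁ h₃).2⟩

/-- Discarding the members of a packing that meet `D` loses at most `D.card` of them. -/
lemma HasPacking.avoid {X : Finset ℕ} {r k : ℕ} {P : Finset ℕ → Prop}
    (h : HasPacking X r k P) (D : Finset ℕ) :
    HasPacking X r (k - D.card) (fun A => Disjoint A D ∧ P A) := by
  obtain ⟨F, hk, hd, hF⟩ := h
  have hle : (F.filter fun A => ¬Disjoint A D).card ≤ D.card := by
    have hex : ∀ A : Finset ℕ, ∃ x, ¬Disjoint A D → x ∈ A ∧ x ∈ D := fun A => by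
      by_cases hA : Disjoint A D
      · exact ⟨0, fun h => absurd hA h⟩
      · obtain ⟨x, h₁, h₂⟩ := Finset.not_disjoint_iff.1 hA
        exact ⟨x, fun _ => ⟨h₁, h₂⟩⟩
    choose x hx using hex
    refine Finset.card_le_card_of_injOn x (fun A hA => (hx A (Finset.mem_filter.1 hA).2).2) ?_
    intro A hA B hB hAB
    obtain ⟨hA, hA'⟩ := Finset.mem_filter.1 hA
    obtain ⟨hB, hB'⟩ := Finset.mem_filter.1 hB
    by_contra hne
    exact Finset.disjoint_left.1 (hd hA hB hne) (hx A hA').1 (hAB ▸ (hx B hB').1)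
  have hcard := Finset.card_filter_add_card_filter_not (s := F) (fun A => Disjoint A D)
  obtain ⟨G, hG, hGk⟩ := Finset.exists_subset_card_eq
    (show k - D.card ≤ (F.filter fun A => Disjoint A D).card by omega)
  refine ⟨G, hGk, hd.mono (Finset.coe_subset.2 (hG.trans (Finset.filter_subset _ _))),
    fun A hA => ?_⟩
  obtain ⟨hAF, hAD⟩ := Finset.mem_filter.1 (hG hA)
  exact ⟨(hF A hAF).1, (hF A hAF).2.1, hAD, (hF A hAF).2.2⟩

/-- The Alon–Frankl–Lovász theorem for three families with parameters `M`, `m`, `m`, `m ≤ M`. -/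
lemma hasPacking_of_three_coloring {r m M : ℕ} (hr : 1 ≤ r) (hm : 1 ≤ m) (hmM : m ≤ M)
    {X : Finset ℕ} (hX : r * M + 2 * (m - 1) ≤ X.card) (c : Finset ℕ → Fin 3) :
    HasPacking X r M (fun A => c A = 0) ∨ HasPacking X r m (fun A => c A = 1) ∨
      HasPacking X r m (fun A => c A = 2) := by
  obtain ⟨D, hDk, hDX⟩ : ∃ D : Finset ℕ, D.card = 2 * (M - m) ∧ Disjoint X D := by
    obtain ⟨D, hD, hk⟩ := Infinite.exists_superset_card_eq X (X.card + 2 * (M - m)) (by omega)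
    refine ⟨D \ X, ?_, Finset.disjoint_sdiff⟩
    rw [Finset.card_sdiff_of_subset hD, hk]
    omega
  obtain ⟨D₁, hD₁, hk₁⟩ := Finset.exists_subset_card_eq (show M - m ≤ D.card by omega)
  have hk₂ : (D \ D₁).card = M - m := by
    rw [Finset.card_sdiff_of_subset hD₁]
    omega
  have hV : M * (r - 1) + 3 * (M - 1) < (X ∪ D).card := by
    rw [Finset.card_union_of_disjoint hDX, Nat.mul_sub_one, mul_comm M r]
    have := Nat.le_mul_of_pos_left M hr
    omega
  let c' : Finset ℕ → Fin 3 := fun A =>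
    if Disjoint A D₁ then if Disjoint A (D \ D₁) then c A else 2 else 1
  have hsub : ∀ A ⊆ X ∪ D, Disjoint A D₁ → Disjoint A (D \ D₁) → A ⊆ X := by
    intro A hA h₁ h₂
    refine Disjoint.left_le_of_le_sup_right hA ?_
    rw [← Finset.union_sdiff_of_subset hD₁]
    exact Finset.disjoint_union_right.2 ⟨h₁, h₂⟩
  obtain ⟨i, hi⟩ := hasPacking_of_coloring M (hm.trans hmM) r hr (X ∪ D) hV c'
  fin_cases i
  · refine Or.inl (hi.mono le_rfl fun A hA hc => ?_)
    by_cases h₁ : Disjoint A D₁ <;> by_cases h₂ : Disjoint A (D \ D₁) <;> simp [c', h₁, h₂] at hc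
    exact ⟨hsub A hA h₁ h₂, hc⟩
  · refine Or.inr (Or.inl ((hi.avoid D₁).mono (by omega) fun A hA hc => ?_))
    obtain ⟨h₁, hc⟩ := hc
    by_cases h₂ : Disjoint A (D \ D₁) <;> simp [c', h₁, h₂] at hc
    exact ⟨hsub A hA h₁ h₂, hc⟩
  · refine Or.inr (Or.inr ((hi.avoid (D \ D₁)).mono (by omega) fun A hA hc => ?_))
    obtain ⟨h₂, hc⟩ := hc
    by_cases h₁ : Disjoint A D₁ <;> simp [c', h₁, h₂] at hc
    exact ⟨hsub A hA h₁ h₂, hc⟩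

/-- Monochromatic cliques found inside a packing with `N` members, when `N` is Ramsey. -/
lemma RamseyProp.exists_of_hasPacking {N a b n r : ℕ} (h : RamseyProp N a b)
    {c : Finset ℕ → Finset ℕ → Bool} (hc : ∀ A B, c A B = c B A) {X : Finset ℕ}
    (hX : X ⊆ Finset.range n) {Q : Finset ℕ → Prop} (hp : HasPacking X r N Q) :
    ∃ S : Finset (Finset ℕ), IsKneserClique n r S ∧ (∀ B ∈ S, B ⊆ X ∧ Q B) ∧
      (S.card = a ∧ MonoClique c true S ∨ S.card = b ∧ MonoClique c false S) := by
  obtain ⟨F, hk, hd, hF⟩ := hp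
  have hsub : ∀ S ⊆ F, IsKneserClique n r S ∧ ∀ B ∈ S, B ⊆ X ∧ Q B := fun S hS =>
    ⟨⟨fun B hB => ⟨(hF B (hS hB)).1.trans hX, (hF B (hS hB)).2.1⟩,
      hd.mono (Finset.coe_subset.2 hS)⟩, fun B hB => ⟨(hF B (hS hB)).1, (hF B (hS hB)).2.2⟩⟩
  rcases h.exists_mono hc hk with ⟨S, hS, hSk, hm⟩ | ⟨S, hS, hSk, hm⟩
  · exact ⟨S, (hsub S hS).1, (hsub S hS).2, Or.inl ⟨hSk, fun A hA B hB => hm hA hB⟩⟩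
  · exact ⟨S, (hsub S hS).1, (hsub S hS).2, Or.inr ⟨hSk, fun A hA B hB => hm hA hB⟩⟩

/-- Adding to a monochromatic clique of a Kneser graph a vertex joined to it in the same color. -/
lemma exists_insert_monoClique {n r k : ℕ} (hr : 1 ≤ r) {c : Finset ℕ → Finset ℕ → Bool}
    (hc : ∀ A B, c A B = c B A) {b : Bool} {S : Finset (Finset ℕ)} (hS : IsKneserClique n r S)
    (hk : S.card = k) (hm : MonoClique c b S) {A : Finset ℕ} (hA : A ⊆ Finset.range n)
    (hAr : A.card = r) (hAS : ∀ B ∈ S, Disjoint A B) (hAb : ∀ B ∈ S, c A B = b) :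
    IsKneserClique n r (insert A S) ∧ (insert A S).card = k + 1 ∧
      MonoClique c b (insert A S) := by
  have hnot : A ∉ S := fun h => by
    have := hAS A h
    rw [disjoint_self, Finset.bot_eq_empty] at this
    simp [this] at hAr
    omega
  refine ⟨⟨fun B hB => ?_, ?_⟩, by rw [Finset.card_insert_of_notMem hnot, hk], ?_⟩
  · rcases Finset.mem_insert.1 hB with rfl | hB
    · exact ⟨hA, hAr⟩
    · exact hS.1 B hB
  · rw [Finset.coe_insert]
    exact Set.pairwise_insert.2 ⟨hS.2, fun B hB _ => ⟨hAS B hB, (hAS B hB).symm⟩⟩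
  · have h : (S : Set (Finset ℕ)).Pairwise fun x y => c x y = b := fun x hx y hy => hm x hx y hy
    have h' := h.insert_color hc hAb
    rw [← Finset.coe_insert] at h'
    exact fun x hx y hy => h' hx hy

/-- An upper bound on the Kneser Ramsey number in terms of Ramsey numbers. Around a blue edge `AB`,
the vertices disjoint from `A ∪ B` are either red to `A`, or red to `B`, or blue to both. -/
theorem kneserRamseyProp_of_ramseyProp {r a M m : ℕ} (hr : 1 ≤ r) (hm : 1 ≤ m) (hmM : m ≤ M)
    (haM : a ≤ M) (hM : RamseyProp M a (a + 2)) (hR : RamseyProp m a (a + 1)) :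
    KneserRamseyProp (r * M + 2 * (m - 1) + 2 * r) r (a + 1) (a + 2) := by
  intro c hc
  set n := r * M + 2 * (m - 1) + 2 * r with hn
  obtain ⟨_, S, hSk, hSd, hS⟩ := hasPacking_of_coloring (t := 1) (a + 1) (by omega) r hr
    (Finset.range n) (by
      have h₁ := Nat.mul_le_mul_left r haM
      have h₂ : (a + 1) * (r - 1) = r * a + r - (a + 1) := by
        rw [Nat.mul_sub_one, add_one_mul, mul_comm a r]
      have h₃ := Nat.le_mul_of_pos_left a hr
      rw [Finset.card_range]
      omega) (fun _ => 0)
  by_cases hred : MonoClique c true S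
  · exact Or.inl ⟨S, ⟨fun A hA => ⟨(hS A hA).1, (hS A hA).2.1⟩, hSd⟩, hSk, hred⟩
  obtain ⟨A, hA, B, hB, hAB, hblue⟩ :
      ∃ A ∈ S, ∃ B ∈ S, A ≠ B ∧ c A B = false := by
    simpa [MonoClique] using hred
  have hdAB := hSd hA hB hAB
  obtain ⟨hAn, hAr, -⟩ := hS A hA
  obtain ⟨hBn, hBr, -⟩ := hS B hB
  have hX : (Finset.range n \ (A ∪ B)).card = r * M + 2 * (m - 1) := by
    rw [Finset.card_sdiff_of_subset (Finset.union_subset hAn hBn),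
      Finset.card_union_of_disjoint hdAB, Finset.card_range]
    omega
  have hdA : ∀ C ⊆ Finset.range n \ (A ∪ B), Disjoint A C := fun C hC =>
    (Finset.disjoint_of_subset_right hC Finset.disjoint_sdiff).mono_left Finset.subset_union_left
  have hdB : ∀ C ⊆ Finset.range n \ (A ∪ B), Disjoint B C := fun C hC =>
    (Finset.disjoint_of_subset_right hC Finset.disjoint_sdiff).mono_left Finset.subset_union_right
  rcases hasPacking_of_three_coloring hr hm hmM hX.ge
    (fun C => if c A C then 0 else if c B C then 1 else 2) with hp | hp | hp
  · obtain ⟨T, hT, hTX, ⟨hk, hmono⟩ | ⟨hk, hmono⟩⟩ :=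
      hM.exists_of_hasPacking hc Finset.sdiff_subset hp
    · refine Or.inl ⟨_, exists_insert_monoClique hr hc hT hk hmono hAn hAr
        (fun C hC => hdA C (hTX C hC).1) fun C hC => ?_⟩
      have := (hTX C hC).2
      split_ifs at this <;> simp_all
    · exact Or.inr ⟨T, hT, hk, hmono⟩
  · have hcol : ∀ C, (if c A C then (0 : Fin 3) else if c B C then 1 else 2) = 1 →
        c A C = false ∧ c B C = true := fun C hC => by
      split_ifs at hC <;> simp_all
    obtain ⟨T, hT, hTX, ⟨hk, hmono⟩ | ⟨hk, hmono⟩⟩ :=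
      hR.exists_of_hasPacking hc Finset.sdiff_subset hp
    · exact Or.inl ⟨_, exists_insert_monoClique hr hc hT hk hmono hBn hBr
        (fun C hC => hdB C (hTX C hC).1) fun C hC => (hcol C (hTX C hC).2).2⟩
    · exact Or.inr ⟨_, exists_insert_monoClique hr hc hT hk hmono hAn hAr
        (fun C hC => hdA C (hTX C hC).1) fun C hC => (hcol C (hTX C hC).2).1⟩
  · have hcol : ∀ C, (if c A C then (0 : Fin 3) else if c B C then 1 else 2) = 2 →
        c A C = false ∧ c B C = false := fun C hC => by
      split_ifs at hC <;> simp_all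
    obtain ⟨T, hT, hTX, ⟨hk, hmono⟩ | ⟨hk, hmono⟩⟩ :=
      hR.symm.exists_of_hasPacking hc Finset.sdiff_subset hp
    · exact Or.inl ⟨T, hT, hk, hmono⟩
    · obtain ⟨hT', hk', hmono'⟩ := exists_insert_monoClique hr hc hT hk hmono hAn hAr
        (fun C hC => hdA C (hTX C hC).1) fun C hC => (hcol C (hTX C hC).2).1
      refine Or.inr ⟨_, exists_insert_monoClique hr hc hT' hk' hmono' hBn hBr
        (fun C hC => ?_) fun C hC => ?_⟩
      · rcases Finset.mem_insert.1 hC with rfl | hC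
        · exact hdAB.symm
        · exact hdB C (hTX C hC).1
      · rcases Finset.mem_insert.1 hC with rfl | hC
        · rw [hc, hblue]
        · exact (hcol C (hTX C hC).2).2

end Kneser

theorem rkg_offdiagonal_upper (r s : ℕ) (hr : 2 ≤ r) (hs : 4 ≤ s) :
    RKG r (s - 1) s ≤
      r * ramseyNumber (s - 2) s + 2 * (ramseyNumber (s - 2) (s - 1) - 1) + 2 * r := by
  obtain ⟨a, rfl⟩ : ∃ a, s = a + 2 := ⟨s - 2, by omega⟩
  exact Nat.sInf_le (kneserRamseyProp_of_ramseyProp (by omega)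
    (ramseyNumber_pos (by omega) (by omega)) (ramseyNumber_mono_right (by omega))
    ((Nat.le_add_right a 2).trans (le_ramseyNumber_right (by omega)))
    (ramseyProp_ramseyNumber a (a + 2)) (ramseyProp_ramseyNumber a (a + 1)))
end

section
/- For every t ≥ 5, RKG_2(3,t) ≤ 2·R(3,t-2) + 2t + 1; i.e., every red/blue edge-coloring of the Kneser graph KG(2R(3,t-2) + 2t + 1, 2) contains a red triangle or a blue clique of size t. -/
open Finset

/-- `M` is a set of pairwise disjoint members of `E`. -/
def IsMatchingIn (E M : Finset (Finset ℕ)) : Prop :=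
  M ⊆ E ∧ (M : Set (Finset ℕ)).Pairwise Disjoint

lemma IsMatchingIn.mono {E M M' : Finset (Finset ℕ)} (h : IsMatchingIn E M) (hM : M' ⊆ M) :
    IsMatchingIn E M' :=
  ⟨hM.trans h.1, h.2.mono (by exact_mod_cast hM)⟩

lemma IsMatchingIn.insert_edge {E M : Finset (Finset ℕ)} (h : IsMatchingIn E M) {p : Finset ℕ}
    (hp : p ∈ E) (hd : ∀ q ∈ M, Disjoint p q) : IsMatchingIn E (insert p M) := by
  refine ⟨insert_subset hp h.1, ?_⟩
  rw [coe_insert]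
  exact h.2.insert fun q hq _ => ⟨hd q hq, (hd q hq).symm⟩

lemma card_biUnion_of_matching {M : Finset (Finset ℕ)} (h2 : ∀ p ∈ M, p.card = 2)
    (hM : (M : Set (Finset ℕ)).Pairwise Disjoint) : (M.biUnion id).card = 2 * M.card := by
  rw [card_biUnion (t := id) (fun p hp q hq hpq => hM hp hq hpq), mul_comm]
  exact sum_const_nat h2

/-- The exchange argument behind Gallai's lemma: if some maximum matching misses `v`, then a
maximum matching missing both `u` and `w` yields one missing `v` together with `u` or `w`. -/
lemma exists_matching_missing {E : Finset (Finset ℕ)} (hE : ∀ p ∈ E, p.card = 2) {k : ℕ}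
    (hk : ∀ M, IsMatchingIn E M → M.card ≤ k) {M N : Finset (Finset ℕ)}
    (hM : IsMatchingIn E M) (hMk : M.card = k) (hN : IsMatchingIn E N) (hNk : N.card = k)
    {u v w : ℕ} (huw : u ≠ w) (hu : u ∉ M.biUnion id) (hw : w ∉ M.biUnion id)
    (hv : v ∉ N.biUnion id) :
    ∃ L, IsMatchingIn E L ∧ L.card = k ∧ v ∉ L.biUnion id ∧
      (u ∉ L.biUnion id ∨ w ∉ L.biUnion id) := by
  classical
  by_contra hcon
  push Not at hcon
  obtain ⟨L, hL, hmax⟩ := exists_max_image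
    (E.powerset.filter fun L => IsMatchingIn E L ∧ L.card = k ∧ v ∉ L.biUnion id)
    (fun L => (M ∩ L).card) ⟨N, by simp only [mem_filter, mem_powerset]; exact ⟨hN.1, hN, hNk, hv⟩⟩
  simp only [mem_filter, mem_powerset] at hL hmax
  obtain ⟨-, hL, hLk, hvL⟩ := hL
  obtain ⟨huL, hwL⟩ := hcon L hL hLk hvL
  have hcard : (M.biUnion id).card = (L.biUnion id).card := by
    rw [card_biUnion_of_matching (fun p hp => hE p (hM.1 hp)) hM.2,
      card_biUnion_of_matching (fun p hp => hE p (hL.1 hp)) hL.2, hMk, hLk]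
  have h2 : 1 < (M.biUnion id \ L.biUnion id).card := by
    rw [card_sdiff_comm hcard]
    exact one_lt_card.2 ⟨u, mem_sdiff.2 ⟨huL, hu⟩, w, mem_sdiff.2 ⟨hwL, hw⟩, huw⟩
  obtain ⟨x, hx, hxv⟩ := exists_mem_ne h2 v
  obtain ⟨hxM, hxL⟩ := mem_sdiff.1 hx
  simp only [mem_biUnion, id, not_exists, not_and] at hxM hxL
  obtain ⟨p, hpM, hxp⟩ := hxM
  obtain ⟨y, hyx, hpy⟩ : ∃ y, y ≠ x ∧ p = {x, y} := by
    obtain ⟨a, b, hab, rfl⟩ := card_eq_two.1 (hE p (hM.1 hpM))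
    rcases mem_insert.1 hxp with rfl | h
    · exact ⟨b, hab.symm, rfl⟩
    · rw [mem_singleton] at h
      subst h
      exact ⟨a, hab, pair_comm _ _⟩
  have hdisj : ∀ q ∈ L, y ∉ q → Disjoint p q := by
    intro q hq hyq
    rw [hpy, disjoint_insert_left, disjoint_singleton_left]
    exact ⟨hxL q hq, hyq⟩
  have hpL : p ∉ L := fun h => hxL p h hxp
  by_cases hyL : y ∈ L.biUnion id
  · simp only [mem_biUnion, id] at hyL
    obtain ⟨q, hqL, hyq⟩ := hyL
    have hqM : q ∉ M := by
      intro h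
      refine disjoint_left.1 (hM.2 h hpM ?_) hyq (by simp [hpy])
      rintro rfl
      exact hpL hqL
    have hL' : IsMatchingIn E (insert p (L.erase q)) := by
      refine (hL.mono (erase_subset _ _)).insert_edge (hM.1 hpM) fun r hr => ?_
      obtain ⟨hrq, hrL⟩ := mem_erase.1 hr
      exact hdisj r hrL fun hyr => disjoint_left.1 (hL.2 hrL hqL hrq) hyr hyq
    have hpe : p ∉ L.erase q := fun h => hpL (mem_of_mem_erase h)
    have hk0 : 0 < L.card := card_pos.2 ⟨q, hqL⟩
    have := hmax (insert p (L.erase q)) ⟨hL'.1, hL', by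
      rw [card_insert_of_notMem hpe, card_erase_of_mem hqL]; omega, by
      simp only [mem_biUnion, id, not_exists, not_and] at hvL ⊢
      intro r hr hvr
      rcases mem_insert.1 hr with rfl | hr
      · rw [hpy, mem_insert, mem_singleton] at hvr
        rcases hvr with rfl | rfl
        · exact hxv rfl
        · exact hvL q hqL hyq
      · exact hvL r (mem_of_mem_erase hr) hvr⟩
    have hsub : insert p (M ∩ L) ⊆ M ∩ insert p (L.erase q) := by
      intro r hr
      simp only [mem_insert, mem_inter, mem_erase] at hr ⊢
      rcases hr with rfl | ⟨hr, hr'⟩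
      · exact ⟨hpM, Or.inl rfl⟩
      · exact ⟨hr, Or.inr ⟨fun h => hqM (h ▸ hr), hr'⟩⟩
    have h3 := card_le_card hsub
    rw [card_insert_of_notMem (fun h => hpL (mem_inter.1 h).2)] at h3
    omega
  · simp only [mem_biUnion, id, not_exists, not_and] at hyL
    have := hk _ (hL.insert_edge (hM.1 hpM) fun q hq => hdisj q hq (hyL q hq))
    rw [card_insert_of_notMem hpL] at this
    omega

/-- A weak form of the Tutte–Berge formula: a graph without matchings of more than `m` edges has
a set `S` of at most `m` vertices whose removal leaves components of order at most
`2 (m - |S|) + 1`. -/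
lemma exists_separator (m : ℕ) : ∀ E : Finset (Finset ℕ), (∀ p ∈ E, p.card = 2) →
    (∀ M, IsMatchingIn E M → M.card ≤ m) →
    ∃ S : Finset ℕ, S ⊆ E.biUnion id ∧ S.card ≤ m ∧ ∃ r : ℕ → ℕ → Prop, Equivalence r ∧
      (∀ p ∈ E, Disjoint p S → ∀ a ∈ p, ∀ b ∈ p, r a b) ∧
      ∀ C : Finset ℕ, Disjoint C S → (∀ a ∈ C, ∀ b ∈ C, r a b) →
        C.card ≤ 2 * (m - S.card) + 1 := by
  classical
  induction m using Nat.strong_induction_on with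
  | _ m ih =>
  intro E hE hm
  obtain ⟨L, hL, hmax⟩ := exists_max_image (E.powerset.filter (IsMatchingIn E)) card
    ⟨∅, by simp [IsMatchingIn]⟩
  simp only [mem_filter, mem_powerset] at hL hmax
  have hLm := hm L hL.2
  have hk : ∀ M, IsMatchingIn E M → M.card ≤ L.card := fun M hM => hmax M ⟨hM.1, hM⟩
  by_cases hess : ∃ v, ∀ M, IsMatchingIn E M → M.card = L.card → v ∈ M.biUnion id
  · obtain ⟨v, hv⟩ := hess
    have hL0 : 0 < L.card := by
      obtain ⟨p, hp, -⟩ := mem_biUnion.1 (hv L hL.2 rfl)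
      exact card_pos.2 ⟨p, hp⟩
    obtain ⟨S, hSE, hSm, r, hr, hrE, hrC⟩ := ih (m - 1) (by omega) (E.filter fun p => v ∉ p)
      (fun p hp => hE p (mem_of_mem_filter p hp)) (by
        intro M hM
        have hM' : IsMatchingIn E M := ⟨hM.1.trans (filter_subset _ _), hM.2⟩
        have h1 := hk M hM'
        have h2 : M.card ≠ L.card := by
          intro h
          obtain ⟨p, hp, hvp⟩ := mem_biUnion.1 (hv M hM' h)
          exact (mem_filter.1 (hM.1 hp)).2 hvp
        omega)
    have hvS : v ∉ S := by
      intro h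
      obtain ⟨p, hp, hvp⟩ := mem_biUnion.1 (hSE h)
      exact (mem_filter.1 hp).2 hvp
    refine ⟨insert v S, insert_subset ?_ ?_, ?_, r, hr, ?_, ?_⟩
    · exact biUnion_subset_biUnion_of_subset_left _ hL.1 (hv L hL.2 rfl)
    · exact hSE.trans (biUnion_subset_biUnion_of_subset_left _ (filter_subset _ _))
    · rw [card_insert_of_notMem hvS]
      omega
    · intro p hp hd
      rw [disjoint_insert_right] at hd
      exact hrE p (mem_filter.2 ⟨hp, hd.1⟩) hd.2
    · intro C hd hC
      rw [disjoint_insert_right] at hd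
      have := hrC C hd.2 hC
      rw [card_insert_of_notMem hvS]
      omega
  · push Not at hess
    refine ⟨∅, by simp, by simp, fun a b => a = b ∨ ∀ M, IsMatchingIn E M → M.card = L.card →
      a ∈ M.biUnion id ∨ b ∈ M.biUnion id, ⟨fun a => Or.inl rfl, ?_, ?_⟩, ?_, ?_⟩
    · rintro a b (h | h)
      · exact Or.inl h.symm
      · exact Or.inr fun M hM hMk => (h M hM hMk).symm
    · rintro a b d (rfl | hab) (rfl | hbd)
      · exact Or.inl rfl
      · exact Or.inr hbd
      · exact Or.inr hab
      · by_contra hcon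
        push Not at hcon
        obtain ⟨had, M, hM, hMk, haM, hdM⟩ := hcon
        obtain ⟨N, hN, hNk, hbN⟩ := hess b
        obtain ⟨K, hK, hKk, hbK, h⟩ :=
          exists_matching_missing hE hk hM hMk hN hNk had haM hdM hbN
        have h1 := hab K hK hKk
        have h2 := hbd K hK hKk
        tauto
    · intro p hp _ a ha b hb
      by_contra hcon
      push Not at hcon
      obtain ⟨hab, M, hM, hMk, haM, hbM⟩ := hcon
      simp only [mem_biUnion, id, not_exists, not_and] at haM hbM
      have hpab : p = {a, b} := (eq_of_subset_of_card_le (by simp [insert_subset_iff, ha, hb])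
        (by rw [hE p hp, card_pair hab])).symm
      have := hk _ (hM.insert_edge hp fun q hq => by
        rw [hpab, disjoint_insert_left, disjoint_singleton_left]
        exact ⟨haM q hq, hbM q hq⟩)
      rw [card_insert_of_notMem fun h => haM p h ha] at this
      omega
    · intro C _ hC
      have h1 : (C \ L.biUnion id).card ≤ 1 := by
        refine card_le_one.2 fun a ha b hb => ?_
        rw [mem_sdiff] at ha hb
        rcases hC a ha.1 b hb.1 with h | h
        · exact h
        · rcases h L hL.2 rfl with h | h
          · exact absurd h ha.2
          · exact absurd h hb.2
      have h2 := card_biUnion_of_matching (fun p hp => hE p (hL.1 hp)) hL.2.2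
      have h3 := card_le_card_sdiff_add_card (s := C) (t := L.biUnion id)
      rw [card_empty]
      omega

lemma total_or_total {P Q : ℕ → ℕ → Prop} (hP : Equivalence P) (hQ : Equivalence Q)
    {U : Finset ℕ} (h : ∀ a ∈ U, ∀ b ∈ U, P a b ∨ Q a b) :
    (∀ a ∈ U, ∀ b ∈ U, P a b) ∨ ∀ a ∈ U, ∀ b ∈ U, Q a b := by
  by_contra hcon
  push Not at hcon
  obtain ⟨⟨a, ha, b, hb, hab⟩, x, hx, y, hy, hxy⟩ := hcon
  have hPs : ∀ {i j}, P i j → P j i := hP.symm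
  have hPt : ∀ {i j k}, P i j → P j k → P i k := hP.trans
  have hQs : ∀ {i j}, Q i j → Q j i := hQ.symm
  have hQt : ∀ {i j k}, Q i j → Q j k → Q i k := hQ.trans
  have h1 := (h a ha b hb).resolve_left hab
  have h2 := (h x hx y hy).resolve_right hxy
  rcases h a ha x hx with h3 | h3
  · rcases h b hb x hx with h4 | h4
    · exact hab (hPt h3 (hPs h4))
    · rcases h b hb y hy with h5 | h5
      · exact hab (hPt (hPt h3 h2) (hPs h5))
      · exact hxy (hQt (hQs h4) h5)
  · rcases h a ha y hy with h4 | h4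
    · rcases h b hb y hy with h5 | h5
      · exact hab (hPt h4 (hPs h5))
      · exact hxy (hQt (hQs h3) (hQt h1 h5))
    · exact hxy (hQt (hQs h3) h4)

open Classical in
/-- The pairs in `W` related by neither `P` nor `Q`. -/
noncomputable def unrelatedPairs (W : Finset ℕ) (P Q : ℕ → ℕ → Prop) : Finset (Finset ℕ) :=
  (W.powersetCard 2).filter fun p => ∀ a ∈ p, ∀ b ∈ p, a ≠ b → ¬ P a b ∧ ¬ Q a b

lemma unrelatedPairs_comm (W : Finset ℕ) (P Q : ℕ → ℕ → Prop) :
    unrelatedPairs W P Q = unrelatedPairs W Q P := by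
  classical
  exact filter_congr fun _ _ => ⟨fun h a ha b hb hab => (h a ha b hb hab).symm,
    fun h a ha b hb hab => (h a ha b hb hab).symm⟩

lemma pair_mem_unrelatedPairs {W : Finset ℕ} {P Q : ℕ → ℕ → Prop} (hP : Equivalence P)
    (hQ : Equivalence Q) {x y : ℕ} :
    {x, y} ∈ unrelatedPairs W P Q ↔ x ∈ W ∧ y ∈ W ∧ ¬ P x y ∧ ¬ Q x y := by
  simp only [unrelatedPairs, mem_filter, mem_powersetCard]
  constructor
  · rintro ⟨⟨h1, h2⟩, h⟩
    have hxy : x ≠ y := by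
      rintro rfl
      simp at h2
    exact ⟨h1 (by simp), h1 (by simp), h x (by simp) y (by simp) hxy⟩
  · rintro ⟨hx, hy, h1, h2⟩
    have hxy : x ≠ y := by
      rintro rfl
      exact h1 (hP.refl x)
    refine ⟨⟨by simp [insert_subset_iff, hx, hy], card_pair hxy⟩, ?_⟩
    intro a ha b hb hab
    rw [mem_insert, mem_singleton] at ha hb
    rcases ha with rfl | rfl <;> rcases hb with rfl | rfl
    · exact absurd rfl hab
    · exact ⟨h1, h2⟩
    · exact ⟨fun h => h1 (hP.symm h), fun h => h2 (hQ.symm h)⟩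
    · exact absurd rfl hab

lemma card_insert_pairs_erase {E M : Finset (Finset ℕ)} (hM : IsMatchingIn E M) {x y u v : ℕ}
    (hxy : {x, y} ∈ M) (hne : x ≠ y) (huv : u ≠ v) (hu : u ∉ M.biUnion id)
    (hv : v ∉ M.biUnion id) (hxu : {x, u} ∈ E) (hyv : {y, v} ∈ E) :
    ∃ L, IsMatchingIn E L ∧ L.card = M.card + 1 := by
  simp only [mem_biUnion, id, not_exists, not_and] at hu hv
  have hxu' : x ≠ u := fun h => hu _ hxy (by simp [h])
  have hxv' : x ≠ v := fun h => hv _ hxy (by simp [h])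
  have hyu' : y ≠ u := fun h => hu _ hxy (by simp [h])
  have hyv' : y ≠ v := fun h => hv _ hxy (by simp [h])
  have key : ∀ z w, z ∈ ({x, y} : Finset ℕ) → (∀ p ∈ M, w ∉ p) → ∀ q ∈ M.erase {x, y},
      Disjoint {z, w} q := by
    intro z w hz hw q hq
    obtain ⟨hq1, hq2⟩ := mem_erase.1 hq
    rw [disjoint_insert_left, disjoint_singleton_left]
    exact ⟨disjoint_left.1 (hM.2 hxy hq2 hq1.symm) hz, hw q hq2⟩
  have h1 := key y v (by simp) hv
  have h2 : ∀ q ∈ insert {y, v} (M.erase {x, y}), Disjoint {x, u} q := by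
    intro q hq
    rcases mem_insert.1 hq with rfl | hq
    · simp [hne.symm, hxv'.symm, hyu', huv.symm]
    · exact key x u (by simp) hu q hq
  refine ⟨_, ((hM.mono (erase_subset {x, y} M)).insert_edge hyv h1).insert_edge hxu h2, ?_⟩
  have h3 : {y, v} ∉ M.erase {x, y} := fun h => hv _ (mem_of_mem_erase h) (by simp)
  have h4 : {x, u} ∉ insert {y, v} (M.erase {x, y}) := fun h => by
    simpa using disjoint_self.1 (h2 _ h)
  rw [card_insert_of_notMem h4, card_insert_of_notMem h3, card_erase_of_mem hxy]
  have := card_pos.2 ⟨_, hxy⟩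
  omega

lemma card_le_card_inter_biUnion {M : Finset (Finset ℕ)}
    (hM : (M : Set (Finset ℕ)).Pairwise Disjoint) {A : Finset ℕ}
    (h : ∀ p ∈ M, ∃ x ∈ p, x ∈ A) : M.card ≤ (A ∩ M.biUnion id).card := by
  choose! g hg hgA using h
  refine card_le_card_of_injOn g (fun p hp => ?_) fun p hp q hq hpq => ?_
  · simp only [coe_inter, Set.mem_inter_iff, mem_coe, mem_biUnion, id]
    exact ⟨hgA p hp, p, hp, hg p hp⟩
  · by_contra hne
    exact disjoint_left.1 (hM hp hq hne) (hg p hp) (hpq ▸ hg q hq)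

/-- A maximum matching of unrelated pairs of size less than `R` cannot miss a `P`-clique. -/
lemma false_of_maximal_unrelated {W : Finset ℕ} {P Q : ℕ → ℕ → Prop} (hP : Equivalence P)
    (hQ : Equivalence Q) {R p q : ℕ} (hp : p + 2 ≤ R)
    (hPC : ∀ C ⊆ W, (∀ a ∈ C, ∀ b ∈ C, P a b) → C.card ≤ 2 * p + 1)
    (hQC : ∀ C ⊆ W, (∀ a ∈ C, ∀ b ∈ C, Q a b) → C.card ≤ 2 * q + 1)
    (hW : 2 * R + p + q ≤ W.card + 1) {M : Finset (Finset ℕ)}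
    (hM : IsMatchingIn (unrelatedPairs W P Q) M) (hMR : M.card < R)
    (hmax : ∀ L, IsMatchingIn (unrelatedPairs W P Q) L → L.card ≤ M.card)
    (hU : 1 < (W \ M.biUnion id).card)
    (hUP : ∀ a ∈ W \ M.biUnion id, ∀ b ∈ W \ M.biUnion id, P a b) : False := by
  classical
  have hM2 : ∀ p ∈ M, p.card = 2 := fun p hp =>
    (mem_powersetCard.1 (mem_filter.1 (hM.1 hp)).1).2
  have hMW : M.biUnion id ⊆ W := biUnion_subset.2 fun p hp =>
    (mem_powersetCard.1 (mem_filter.1 (hM.1 hp)).1).1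
  have hWcard : (W \ M.biUnion id).card + 2 * M.card = W.card := by
    rw [← card_biUnion_of_matching hM2 hM.2]
    exact card_sdiff_add_card_eq_card hMW
  have haug : ∀ x y u v, {x, y} ∈ M → x ≠ y → u ≠ v → u ∈ W \ M.biUnion id →
      v ∈ W \ M.biUnion id → ¬ P x u → ¬ P y v → ¬ Q x u → ¬ Q y v → False := by
    intro x y u v hxy hne huv hu hv h1 h2 h3 h4
    rw [mem_sdiff] at hu hv
    obtain ⟨hx, hy, -⟩ := (pair_mem_unrelatedPairs hP hQ).1 (hM.1 hxy)
    obtain ⟨L, hL, hLM⟩ := card_insert_pairs_erase hM hxy hne huv hu.2 hv.2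
      ((pair_mem_unrelatedPairs hP hQ).2 ⟨hx, hu.1, h1, h3⟩)
      ((pair_mem_unrelatedPairs hP hQ).2 ⟨hy, hv.1, h2, h4⟩)
    have := hmax L hL
    omega
  have hclass : ∀ {T : ℕ → ℕ → Prop} (_ : Equivalence T) (a : ℕ),
      (∀ u ∈ W \ M.biUnion id, T a u) → (W \ M.biUnion id).card +
        (W.filter (T a) ∩ M.biUnion id).card ≤ (W.filter (T a)).card := by
    intro T _ a ha
    rw [← card_sdiff_add_card_inter (W.filter (T a)) (M.biUnion id)]
    refine Nat.add_le_add_right (card_le_card fun u hu => ?_) _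
    have := mem_sdiff.1 hu
    exact mem_sdiff.2 ⟨mem_filter.2 ⟨this.1, ha u hu⟩, this.2⟩
  have hclique : ∀ {T : ℕ → ℕ → Prop} (_ : Equivalence T) (a : ℕ),
      ∀ b ∈ W.filter (T a), ∀ d ∈ W.filter (T a), T b d := by
    intro T hT a b hb d hd
    exact hT.trans (hT.symm (mem_filter.1 hb).2) (mem_filter.1 hd).2
  obtain ⟨a, ha⟩ := card_pos.1 (Nat.zero_lt_of_lt hU)
  have hPa := hclass hP a (hUP a ha)
  have hPc := hPC _ (filter_subset _ _) (hclique hP a)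
  by_cases hUQ : ∀ u ∈ W \ M.biUnion id, ∀ v ∈ W \ M.biUnion id, Q u v
  · have hQa := hclass hQ a (hUQ a ha)
    have hQc := hQC _ (filter_subset _ _) (hclique hQ a)
    have hcov : ∀ p ∈ M, ∃ x ∈ p, x ∈ W.filter (P a) ∪ W.filter (Q a) := by
      intro p hp
      obtain ⟨x, y, hxy, rfl⟩ := card_eq_two.1 (hM2 p hp)
      obtain ⟨hx, hy, -⟩ := (pair_mem_unrelatedPairs hP hQ).1 (hM.1 hp)
      by_contra hcon
      push Not at hcon
      have h1 := hcon x (by simp)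
      have h2 := hcon y (by simp)
      simp only [mem_union, mem_filter, hx, hy, true_and, not_or] at h1 h2
      obtain ⟨u, hu, v, hv, huv⟩ := one_lt_card.1 hU
      exact haug x y u v hp hxy huv hu hv
        (fun h => h1.1 (hP.trans (hUP a ha u hu) (hP.symm h)))
        (fun h => h2.1 (hP.trans (hUP a ha v hv) (hP.symm h)))
        (fun h => h1.2 (hQ.trans (hUQ a ha u hu) (hQ.symm h)))
        (fun h => h2.2 (hQ.trans (hUQ a ha v hv) (hQ.symm h)))
    have h1 := card_le_card_inter_biUnion hM.2 hcov
    rw [union_inter_distrib_right] at h1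
    have h2 := card_union_le (W.filter (P a) ∩ M.biUnion id) (W.filter (Q a) ∩ M.biUnion id)
    omega
  · push Not at hUQ
    obtain ⟨u, hu, v, hv, huv⟩ := hUQ
    have hne : u ≠ v := by
      rintro rfl
      exact huv (hQ.refl u)
    have hcov : ∀ p ∈ M, ∃ x ∈ p, x ∈ W.filter (P a) := by
      intro p hp
      obtain ⟨x, y, hxy, rfl⟩ := card_eq_two.1 (hM2 p hp)
      obtain ⟨hx, hy, -, hQxy⟩ := (pair_mem_unrelatedPairs hP hQ).1 (hM.1 hp)
      by_contra hcon
      push Not at hcon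
      have h1 := hcon x (by simp)
      have h2 := hcon y (by simp)
      simp only [mem_filter, hx, hy, true_and] at h1 h2
      have h1' : ∀ w ∈ W \ M.biUnion id, ¬ P x w := fun w hw h =>
        h1 (hP.trans (hUP a ha w hw) (hP.symm h))
      have h2' : ∀ w ∈ W \ M.biUnion id, ¬ P y w := fun w hw h =>
        h2 (hP.trans (hUP a ha w hw) (hP.symm h))
      have h3 := haug x y u v hp hxy hne hu hv (h1' u hu) (h2' v hv)
      have h4 := haug x y v u hp hxy hne.symm hv hu (h1' v hv) (h2' u hu)
      by_cases hxu : Q x u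
      · by_cases hxv : Q x v
        · exact huv (hQ.trans (hQ.symm hxu) hxv)
        · exact h4 hxv fun h => hQxy (hQ.trans hxu (hQ.symm h))
      · by_cases hyv : Q y v
        · exact h4 (fun h => hQxy (hQ.trans h (hQ.symm hyv)))
            fun h => huv (hQ.trans (hQ.symm h) hyv)
        · exact h3 hxu hyv
    have h1 := card_le_card_inter_biUnion hM.2 hcov
    omega

lemma card_le_of_no_unrelated_matching {W : Finset ℕ} {P Q : ℕ → ℕ → Prop} (hP : Equivalence P)
    (hQ : Equivalence Q) {R p q : ℕ} (hp : p + 2 ≤ R) (hq : q + 2 ≤ R)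
    (hPC : ∀ C ⊆ W, (∀ a ∈ C, ∀ b ∈ C, P a b) → C.card ≤ 2 * p + 1)
    (hQC : ∀ C ⊆ W, (∀ a ∈ C, ∀ b ∈ C, Q a b) → C.card ≤ 2 * q + 1)
    (hW : 2 * R + p + q ≤ W.card + 1)
    (hR : ∀ M, IsMatchingIn (unrelatedPairs W P Q) M → M.card < R) :
    W.card + 1 ≤ 2 * R := by
  classical
  obtain ⟨M, hM, hmax⟩ := exists_max_image
    ((unrelatedPairs W P Q).powerset.filter (IsMatchingIn (unrelatedPairs W P Q))) card
    ⟨∅, by simp [IsMatchingIn]⟩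
  simp only [mem_filter, mem_powerset] at hM hmax
  replace hM := hM.2
  replace hmax : ∀ L, IsMatchingIn (unrelatedPairs W P Q) L → L.card ≤ M.card :=
    fun L hL => hmax L ⟨hL.1, hL⟩
  have hMR := hR M hM
  rcases le_or_gt (W \ M.biUnion id).card 1 with hU | hU
  · have h1 := card_biUnion_of_matching (fun p hp =>
      (mem_powersetCard.1 (mem_filter.1 (hM.1 hp)).1).2) hM.2
    have h2 := card_le_card_sdiff_add_card (s := W) (t := M.biUnion id)
    omega
  · exfalso
    have htot : ∀ a ∈ W \ M.biUnion id, ∀ b ∈ W \ M.biUnion id, P a b ∨ Q a b := by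
      intro a ha b hb
      by_contra hcon
      push Not at hcon
      rw [mem_sdiff] at ha hb
      have haM := ha.2
      have hbM := hb.2
      simp only [mem_biUnion, id, not_exists, not_and] at haM hbM
      have := hmax _ (hM.insert_edge ((pair_mem_unrelatedPairs hP hQ).2 ⟨ha.1, hb.1, hcon⟩)
        fun q hq => by
          rw [disjoint_insert_left, disjoint_singleton_left]
          exact ⟨haM q hq, hbM q hq⟩)
      rw [card_insert_of_notMem fun h => haM _ h (by simp)] at this
      omega
    rcases total_or_total hP hQ htot with h | h
    · exact false_of_maximal_unrelated hP hQ hp hPC hQC hW hM hMR hmax hU h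
    · rw [unrelatedPairs_comm] at hM hmax
      exact false_of_maximal_unrelated hQ hP hq hQC hPC (by omega) hM hMR hmax hU h

lemma exists_matching_pairs (k : ℕ) : ∀ A : Finset ℕ, 2 * k ≤ A.card →
    ∃ M, IsMatchingIn (A.powersetCard 2) M ∧ M.card = k := by
  induction k with
  | zero => exact fun A _ => ⟨∅, by simp [IsMatchingIn], rfl⟩
  | succ k ih =>
    intro A hA
    obtain ⟨p, hpA, hp⟩ := exists_subset_card_eq (show 2 ≤ A.card by omega)
    obtain ⟨M, hM, hMk⟩ := ih (A \ p) (by rw [card_sdiff_of_subset hpA]; omega)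
    have hd : ∀ q ∈ M, Disjoint p q := fun q hq =>
      disjoint_sdiff.mono_right (mem_powersetCard.1 (hM.1 hq)).1
    have hpM : p ∉ M := fun h => by
      have := disjoint_self.1 (hd p h)
      simp [this] at hp
    refine ⟨insert p M, IsMatchingIn.insert_edge ⟨fun q hq => ?_, hM.2⟩
      (mem_powersetCard.2 ⟨hpA, hp⟩) hd, by rw [card_insert_of_notMem hpM, hMk]⟩
    have := mem_powersetCard.1 (hM.1 hq)
    exact mem_powersetCard.2 ⟨this.1.trans sdiff_subset, this.2⟩

/-- Vertices of degree at least `2 |S|` can be matched greedily. -/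
lemma exists_matching_of_degree {E : Finset (Finset ℕ)} (S : Finset ℕ) (Y : ℕ → Finset ℕ)
    (hY : ∀ x ∈ S, 2 * S.card ≤ (Y x).card) (hYE : ∀ x ∈ S, ∀ y ∈ Y x, {x, y} ∈ E) :
    ∃ M, IsMatchingIn E M ∧ M.card = S.card := by
  suffices h : ∀ T ⊆ S, ∃ M, IsMatchingIn E M ∧ M.card = T.card ∧
      Disjoint (M.biUnion id) (S \ T) ∧ (M.biUnion id \ S).card ≤ T.card by
    obtain ⟨M, hM, hMS, -⟩ := h S subset_rfl
    exact ⟨M, hM, hMS⟩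
  intro T
  induction T using Finset.induction_on with
  | empty => exact fun _ => ⟨∅, by simp [IsMatchingIn], by simp⟩
  | insert x T hx ih =>
    intro hT
    obtain ⟨hxS, hTS⟩ := insert_subset_iff.1 hT
    obtain ⟨M, hM, hMT, hMd, hMc⟩ := ih hTS
    have hlt := card_lt_card (ssubset_iff.2 ⟨x, hx, hT⟩)
    obtain ⟨y, hy, hyn⟩ : ∃ y ∈ Y x, y ∉ S ∪ (M.biUnion id \ S) := by
      refine exists_mem_notMem_of_card_lt_card ?_
      have h1 := card_union_le S (M.biUnion id \ S)
      have h2 := hY x hxS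
      omega
    simp only [mem_union, mem_sdiff, not_or, not_and, not_not] at hyn
    have hyM : y ∉ M.biUnion id := fun h => hyn.1 (hyn.2 h)
    have hxM : x ∉ M.biUnion id := fun h => disjoint_left.1 hMd h (mem_sdiff.2 ⟨hxS, hx⟩)
    have hcov : (insert {x, y} M).biUnion id = insert x (insert y (M.biUnion id)) := by
      rw [biUnion_insert]
      simp [insert_union]
    refine ⟨insert {x, y} M, hM.insert_edge (hYE x hxS y hy) fun q hq => ?_, ?_, ?_, ?_⟩
    · simp only [mem_biUnion, id, not_exists, not_and] at hxM hyM
      rw [disjoint_insert_left, disjoint_singleton_left]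
      exact ⟨hxM q hq, hyM q hq⟩
    · rw [card_insert_of_notMem, card_insert_of_notMem hx, hMT]
      exact fun h => hxM (mem_biUnion.2 ⟨_, h, by simp⟩)
    · rw [hcov, disjoint_insert_left, disjoint_insert_left]
      refine ⟨by simp, by simp [hyn.1], hMd.mono_right (sdiff_subset_sdiff subset_rfl ?_)⟩
      exact subset_insert _ _
    · rw [hcov, insert_sdiff_of_mem _ hxS, insert_sdiff_of_notMem _ hyn.1,
        card_insert_of_notMem hx]
      exact (card_insert_le _ _).trans (by omega)

/-- A coloring of `KG(N,2)` without red triangle and blue `t`-clique. -/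
structure IsAvoiding (c : Finset ℕ → Finset ℕ → Bool) (N t : ℕ) : Prop where
  symm : ∀ A B, c A B = c B A
  no_red : ∀ S, IsKneserClique N 2 S → S.card = 3 → ¬ MonoClique c true S
  no_blue : ∀ S, IsKneserClique N 2 S → S.card = t → ¬ MonoClique c false S

/-- The red neighbors of `e` in `KG(N,2)`, as a graph on `[N]`. -/
def redGraph (c : Finset ℕ → Finset ℕ → Bool) (N : ℕ) (e : Finset ℕ) : Finset (Finset ℕ) :=
  ((range N \ e).powersetCard 2).filter fun p => c e p = true

lemma mem_redGraph {c : Finset ℕ → Finset ℕ → Bool} {N : ℕ} {e p : Finset ℕ} :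
    p ∈ redGraph c N e ↔ (p ⊆ range N ∧ p.card = 2) ∧ Disjoint e p ∧ c e p = true := by
  simp only [redGraph, mem_filter, mem_powersetCard, subset_sdiff, disjoint_comm (a := p)]
  tauto

/-- A set of `t - 1` vertices, each of degree at least `2t` among the red neighbors of `e`. -/
def IsHeavySet (c : Finset ℕ → Finset ℕ → Bool) (N t : ℕ) (e S : Finset ℕ) : Prop :=
  S.card = t - 1 ∧
    ∀ x ∈ S, ∃ Y : Finset ℕ, 2 * t ≤ Y.card ∧ ∀ y ∈ Y, {x, y} ∈ redGraph c N e

lemma ne_of_disjoint_of_card {A B : Finset ℕ} (h : Disjoint A B) (hA : A.card = 2) : A ≠ B := by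
  rintro rfl
  rw [disjoint_self.1 h] at hA
  simp at hA

namespace IsAvoiding

variable {c : Finset ℕ → Finset ℕ → Bool} {N t : ℕ}

lemma not_red_triangle (h : IsAvoiding c N t) {A B D : Finset ℕ} (hA : A ⊆ range N ∧ A.card = 2)
    (hB : B ⊆ range N ∧ B.card = 2) (hD : D ⊆ range N ∧ D.card = 2) (hAB : Disjoint A B)
    (hAD : Disjoint A D) (hBD : Disjoint B D) (h1 : c A B = true) (h2 : c A D = true)
    (h3 : c B D = true) : False := by
  have hAB' := ne_of_disjoint_of_card hAB hA.2
  have hAD' := ne_of_disjoint_of_card hAD hA.2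
  have hBD' := ne_of_disjoint_of_card hBD hB.2
  refine h.no_red {A, B, D} ⟨by simp [hA, hB, hD], ?_⟩ (card_eq_three.2
    ⟨A, B, D, hAB', hAD', hBD', rfl⟩) ?_
  · intro X hX Y hY hXY
    simp only [coe_insert, coe_singleton, Set.mem_insert_iff, Set.mem_singleton_iff] at hX hY
    rcases hX with rfl | rfl | rfl <;> rcases hY with rfl | rfl | rfl <;>
      first | exact absurd rfl hXY | assumption | (apply Disjoint.symm; assumption)
  · intro X hX Y hY hXY
    simp only [mem_insert, mem_singleton] at hX hY
    rcases hX with rfl | rfl | rfl <;> rcases hY with rfl | rfl | rfl <;>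
      first | exact absurd rfl hXY | assumption | (rw [h.symm]; assumption)

lemma card_matching_redGraph_lt (h : IsAvoiding c N t)
    {e : Finset ℕ} (he : e ⊆ range N ∧ e.card = 2)
    {M : Finset (Finset ℕ)} (hM : IsMatchingIn (redGraph c N e) M) : M.card < t := by
  by_contra! hcon
  obtain ⟨L, hLM, hLt⟩ := exists_subset_card_eq hcon
  replace hM := hM.mono hLM
  refine h.no_blue L ⟨fun A hA => (mem_redGraph.1 (hM.1 hA)).1, hM.2⟩ hLt ?_
  intro A hA B hB hAB
  obtain ⟨hA2, heA, hcA⟩ := mem_redGraph.1 (hM.1 hA)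
  obtain ⟨hB2, heB, hcB⟩ := mem_redGraph.1 (hM.1 hB)
  by_contra hc
  exact h.not_red_triangle he hA2 hB2 heA heB (hM.2 hA hB hAB) hcA hcB (by simpa using hc)

/-- Heavy sets of `e` are unique; only one inclusion is needed. -/
lemma heavySet_subset (h : IsAvoiding c N t)
    {e S S' : Finset ℕ} (he : e ⊆ range N ∧ e.card = 2) (ht : 0 < t)
    (hS : IsHeavySet c N t e S) (hS' : IsHeavySet c N t e S') : S ⊆ S' := by
  by_contra hcon
  obtain ⟨x, hx, hxS'⟩ := not_subset.1 hcon
  have hcard : (insert x S').card = t := by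
    rw [card_insert_of_notMem hxS', hS'.1]
    omega
  have hdeg : ∀ z ∈ insert x S', ∃ Y : Finset ℕ, 2 * t ≤ Y.card ∧
      ∀ y ∈ Y, {z, y} ∈ redGraph c N e := by
    intro z hz
    rcases mem_insert.1 hz with rfl | hz
    · exact hS.2 z hx
    · exact hS'.2 z hz
  choose! Y hY hYE using hdeg
  obtain ⟨M, hM, hMc⟩ := exists_matching_of_degree (insert x S') Y (by rwa [hcard]) hYE
  have := h.card_matching_redGraph_lt he hM
  omega

/-- A matching of common blue neighbors of a blue pair has fewer than `R(3,t-2)` edges. -/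
lemma card_blue_matching_lt (h : IsAvoiding c N t)
    {R : ℕ} (hR : RamseyProp R 3 (t - 2)) (ht : 2 ≤ t) {e f : Finset ℕ}
    (he : e ⊆ range N ∧ e.card = 2) (hf : f ⊆ range N ∧ f.card = 2) (hef : Disjoint e f)
    (hc : c e f = false) {M : Finset (Finset ℕ)}
    (hM : (M : Set (Finset ℕ)).Pairwise Disjoint)
    (hMN : ∀ p ∈ M, p ⊆ range N \ (e ∪ f) ∧ p.card = 2 ∧ c e p = false ∧ c f p = false) :
    M.card < R := by
  by_contra! hcon
  obtain ⟨φ⟩ : Nonempty (Fin R ↪ M) :=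
    Function.Embedding.nonempty_of_card_le (by simpa using hcon)
  let g : ℕ → Finset ℕ := fun i => if hi : i < R then (φ ⟨i, hi⟩ : Finset ℕ) else ∅
  have hgM : ∀ i ∈ range R, g i ∈ M := by
    intro i hi
    simp [g, mem_range.1 hi]
  have hginj : Set.InjOn g (range R) := by
    intro i hi j hj hij
    have hi' := mem_range.1 (mem_coe.1 hi)
    have hj' := mem_range.1 (mem_coe.1 hj)
    simp only [g, hi', hj', dif_pos] at hij
    simpa using φ.injective (Subtype.ext hij)
  have hgN : ∀ i ∈ range R, (g i ⊆ range N ∧ (g i).card = 2) ∧ Disjoint e (g i) ∧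
      Disjoint f (g i) ∧ c e (g i) = false ∧ c f (g i) = false := by
    intro i hi
    obtain ⟨h1, h2, h3, h4⟩ := hMN _ (hgM i hi)
    rw [subset_sdiff, disjoint_union_right] at h1
    exact ⟨⟨h1.1, h2⟩, h1.2.1.symm, h1.2.2.symm, h3, h4⟩
  have hgd : ∀ i ∈ range R, ∀ j ∈ range R, i ≠ j → Disjoint (g i) (g j) :=
    fun i hi j hj hij => hM (hgM i hi) (hgM j hj) fun hg => hij (hginj hi hj hg)
  rcases hR (fun i j => c (g i) (g j)) (fun i j => h.symm _ _) with
    ⟨S, hSR, hS3, hS⟩ | ⟨S, hSR, hSt, hS⟩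
  · obtain ⟨i, j, k, hij, hik, hjk, rfl⟩ := card_eq_three.1 hS3
    have hi := hSR (show i ∈ _ by simp)
    have hj := hSR (show j ∈ _ by simp)
    have hk := hSR (show k ∈ _ by simp)
    exact h.not_red_triangle (hgN i hi).1 (hgN j hj).1 (hgN k hk).1 (hgd i hi j hj hij)
      (hgd i hi k hk hik) (hgd j hj k hk hjk) (hS i (by simp) j (by simp) hij)
      (hS i (by simp) k (by simp) hik) (hS j (by simp) k (by simp) hjk)
  · have hfS : f ∉ S.image g := by
      intro hfS
      obtain ⟨i, hi, rfl⟩ := mem_image.1 hfS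
      exact ne_of_disjoint_of_card (hgN i (hSR hi)).2.2.1 hf.2 rfl
    have heS : e ∉ insert f (S.image g) := by
      intro heS
      rcases mem_insert.1 heS with rfl | heS
      · exact ne_of_disjoint_of_card hef he.2 rfl
      · obtain ⟨i, hi, rfl⟩ := mem_image.1 heS
        exact ne_of_disjoint_of_card (hgN i (hSR hi)).2.1 he.2 rfl
    refine h.no_blue (insert e (insert f (S.image g))) ⟨?_, ?_⟩ ?_ ?_
    · intro A hA
      simp only [mem_insert, mem_image] at hA
      rcases hA with rfl | rfl | ⟨i, hi, rfl⟩
      · exact he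
      · exact hf
      · exact (hgN i (hSR hi)).1
    · intro A hA B hB hAB
      simp only [mem_coe, mem_insert, mem_image] at hA hB
      rcases hA with rfl | rfl | ⟨i, hi, rfl⟩ <;> rcases hB with rfl | rfl | ⟨j, hj, rfl⟩
      · exact absurd rfl hAB
      · exact hef
      · exact (hgN j (hSR hj)).2.1
      · exact hef.symm
      · exact absurd rfl hAB
      · exact (hgN j (hSR hj)).2.2.1
      · exact (hgN i (hSR hi)).2.1.symm
      · exact (hgN i (hSR hi)).2.2.1.symm
      · exact hgd i (hSR hi) j (hSR hj) fun hij => hAB (hij ▸ rfl)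
    · rw [card_insert_of_notMem heS, card_insert_of_notMem hfS,
        card_image_of_injOn (hginj.mono (by exact_mod_cast hSR)), hSt]
      omega
    · intro A hA B hB hAB
      simp only [mem_insert, mem_image] at hA hB
      rcases hA with rfl | rfl | ⟨i, hi, rfl⟩ <;> rcases hB with rfl | rfl | ⟨j, hj, rfl⟩
      · exact absurd rfl hAB
      · exact hc
      · exact (hgN j (hSR hj)).2.2.2.1
      · rw [h.symm, hc]
      · exact absurd rfl hAB
      · exact (hgN j (hSR hj)).2.2.2.2
      · rw [h.symm, (hgN i (hSR hi)).2.2.2.1]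
      · rw [h.symm, (hgN i (hSR hi)).2.2.2.2]
      · exact hS i hi j hj fun hij => hAB (hij ▸ rfl)

lemma exists_separator_redGraph (h : IsAvoiding c N t)
    {e : Finset ℕ} (he : e ⊆ range N ∧ e.card = 2) (V : Finset ℕ) :
    ∃ S : Finset ℕ, S ⊆ V ∧ S.card ≤ t - 1 ∧ ∃ r : ℕ → ℕ → Prop, Equivalence r ∧
      (∀ p ∈ redGraph c N e, p ⊆ V → Disjoint p S → ∀ a ∈ p, ∀ b ∈ p, r a b) ∧
      ∀ C : Finset ℕ, Disjoint C S → (∀ a ∈ C, ∀ b ∈ C, r a b) →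
        C.card ≤ 2 * (t - 1 - S.card) + 1 := by
  obtain ⟨S, hSV, hSt, r, hr, hrE, hrC⟩ := exists_separator (t - 1)
    ((redGraph c N e).filter (· ⊆ V))
    (fun p hp => (mem_redGraph.1 (mem_filter.1 hp).1).1.2) fun M hM => by
      have := h.card_matching_redGraph_lt he ⟨hM.1.trans (filter_subset _ _), hM.2⟩
      omega
  refine ⟨S, hSV.trans (biUnion_subset.2 fun p hp => (mem_filter.1 hp).2), hSt, r, hr, ?_, hrC⟩
  exact fun p hp hpV => hrE p (mem_filter.2 ⟨hp, hpV⟩)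

/-- In a blue pair of disjoint edges, the first has a heavy set avoiding the second. -/
lemma exists_heavySet (h : IsAvoiding c N t)
    {R : ℕ} (hR : RamseyProp R 3 (t - 2)) (ht : 2 ≤ t) (htR : t + 1 ≤ R)
    (hN : N = 2 * R + 2 * t + 1) {e f : Finset ℕ} (he : e ⊆ range N ∧ e.card = 2)
    (hf : f ⊆ range N ∧ f.card = 2) (hef : Disjoint e f) (hc : c e f = false) :
    ∃ S, IsHeavySet c N t e S ∧ Disjoint S f := by
  classical
  obtain ⟨V, hV⟩ : ∃ V, V = range N \ (e ∪ f) := ⟨_, rfl⟩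
  have hVcard : V.card + 4 = N := by
    rw [hV, card_sdiff_of_subset (union_subset he.1 hf.1), card_union_of_disjoint hef, he.2, hf.2,
      card_range]
    omega
  obtain ⟨S, hSV, hSt, P, hP, hPE, hPC⟩ := h.exists_separator_redGraph he V
  obtain ⟨T, hTV, hTt, Q, hQ, hQE, hQC⟩ := h.exists_separator_redGraph hf V
  have hdis : ∀ p ⊆ V, Disjoint e p ∧ Disjoint f p := by
    intro p hp
    rw [hV, subset_sdiff, disjoint_union_right] at hp
    exact ⟨hp.2.1.symm, hp.2.2.symm⟩
  have hVN : V ⊆ range N := hV ▸ sdiff_subset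
  -- pairs in `V` that are not red to `e` and not red to `f` do not have matchings of size `R`
  have hblue : ∀ M : Finset (Finset ℕ), (M : Set (Finset ℕ)).Pairwise Disjoint →
      (∀ p ∈ M, p ⊆ V ∧ p.card = 2 ∧ p ∉ redGraph c N e ∧ p ∉ redGraph c N f) →
      M.card < R := by
    intro M hM hMV
    refine h.card_blue_matching_lt hR ht he hf hef hc hM fun p hp => ?_
    obtain ⟨h1, h2, h3, h4⟩ := hMV p hp
    have h5 := hdis p h1
    simp only [mem_redGraph, h1.trans hVN, h2, h5, true_and, and_self, Bool.not_eq_true] at h3 h4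
    exact ⟨hV ▸ h1, h2, h3, h4⟩
  obtain ⟨W, hWdef⟩ : ∃ W, W = V \ (S ∪ T) := ⟨_, rfl⟩
  have hWcard : W.card + (S ∪ T).card = V.card := by
    rw [hWdef]
    exact card_sdiff_add_card_eq_card (union_subset hSV hTV)
  have hST := card_union_add_card_inter S T
  have hWS : W ⊆ V ∧ Disjoint W S ∧ Disjoint W T := by
    rw [hWdef]
    refine ⟨sdiff_subset, ?_, ?_⟩
    · exact sdiff_disjoint.mono_right subset_union_left
    · exact sdiff_disjoint.mono_right subset_union_right
  have hWle : W.card + 1 ≤ 2 * R := by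
    refine card_le_of_no_unrelated_matching hP hQ (p := t - 1 - S.card) (q := t - 1 - T.card)
      (by omega) (by omega) (fun C hC => hPC C (hWS.2.1.mono_left hC))
      (fun C hC => hQC C (hWS.2.2.mono_left hC)) (by omega) fun M hM => hblue M hM.2 fun p hp => ?_
    obtain ⟨hpW, hpu⟩ := mem_filter.1 (hM.1 hp)
    obtain ⟨hpW, hp2⟩ := mem_powersetCard.1 hpW
    obtain ⟨a, b, hab, rfl⟩ := card_eq_two.1 hp2
    have := hpu a (by simp) b (by simp) hab
    refine ⟨hpW.trans hWS.1, hp2, fun hr => this.1 ?_, fun hr => this.2 ?_⟩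
    · exact hPE _ hr (hpW.trans hWS.1) (hWS.2.1.mono_left hpW) a (by simp) b (by simp)
    · exact hQE _ hr (hpW.trans hWS.1) (hWS.2.2.mono_left hpW) a (by simp) b (by simp)
  have hSc : S.card = t - 1 := by omega
  have hTc : T.card = t - 1 := by omega
  have hSTd : Disjoint S T := disjoint_iff_inter_eq_empty.2 (card_eq_zero.1 (by omega))
  have hPtouch : ∀ p, p ⊆ V → p.card = 2 → Disjoint p S → p ∉ redGraph c N e := by
    intro p hpV hp2 hpS hp
    have := hPC p hpS (hPE p hp hpV hpS)
    omega
  have hQtouch : ∀ p, p ⊆ V → p.card = 2 → Disjoint p T → p ∉ redGraph c N f := by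
    intro p hpV hp2 hpT hp
    have := hQC p hpT (hQE p hp hpV hpT)
    omega
  refine ⟨S, ⟨hSc, fun x hx => ⟨W, by omega, fun y hy => ?_⟩⟩, (hdis S hSV).2.symm⟩
  by_contra hred
  have hxW : x ∉ W := fun hxW => disjoint_left.1 hWS.2.1 hxW hx
  have hxy : x ≠ y := by
    rintro rfl
    exact hxW hy
  obtain ⟨M, hM, hMc⟩ := exists_matching_pairs (R - 1) (W.erase y)
    (by rw [card_erase_of_mem hy]; omega)
  have hd : ∀ q ∈ M, Disjoint {x, y} q := by
    intro q hq
    have hqW := (mem_powersetCard.1 (hM.1 hq)).1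
    rw [disjoint_insert_left, disjoint_singleton_left]
    exact ⟨fun hxq => hxW (mem_of_mem_erase (hqW hxq)), fun hyq => notMem_erase y W (hqW hyq)⟩
  have hxyM : {x, y} ∉ M := fun hxyM =>
    ne_of_disjoint_of_card (hd _ hxyM) (card_pair hxy) rfl
  have hlt := hblue (insert {x, y} M) (by
    rw [coe_insert]
    exact hM.2.insert fun q hq _ => ⟨hd q hq, (hd q hq).symm⟩) fun p hp => by
      rcases mem_insert.1 hp with rfl | hp
      · have hxyV : {x, y} ⊆ V := by simp [insert_subset_iff, hSV hx, hWS.1 hy]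
        refine ⟨hxyV, card_pair hxy, hred, hQtouch _ hxyV (card_pair hxy) ?_⟩
        rw [disjoint_insert_left, disjoint_singleton_left]
        exact ⟨disjoint_left.1 hSTd hx, disjoint_left.1 hWS.2.2 hy⟩
      · obtain ⟨hpW, hp2⟩ := mem_powersetCard.1 (hM.1 hp)
        replace hpW := hpW.trans (erase_subset y W)
        exact ⟨hpW.trans hWS.1, hp2, hPtouch p (hpW.trans hWS.1) hp2 (hWS.2.1.mono_left hpW),
          hQtouch p (hpW.trans hWS.1) hp2 (hWS.2.2.mono_left hpW)⟩
  rw [card_insert_of_notMem hxyM] at hlt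
  omega

/-- Every `e` is red to all disjoint pairs that meet some fixed set of `t - 1` vertices. -/
lemma exists_red_cover (h : IsAvoiding c N t)
    {R : ℕ} (hR : RamseyProp R 3 (t - 2)) (ht : 2 ≤ t) (htR : t + 1 ≤ R)
    (hN : N = 2 * R + 2 * t + 1) {e : Finset ℕ} (he : e ⊆ range N ∧ e.card = 2) :
    ∃ S ⊆ range N, S.card = t - 1 ∧ Disjoint e S ∧ ∀ g ⊆ range N, g.card = 2 → Disjoint e g →
      ¬ Disjoint S g → c e g = true := by
  obtain ⟨f, hf, hef, hc⟩ : ∃ f, (f ⊆ range N ∧ f.card = 2) ∧ Disjoint e f ∧ c e f = false := by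
    by_contra! hcon
    obtain ⟨M, hM, hMc⟩ := exists_matching_pairs t (range N \ e) (by
      rw [card_sdiff_of_subset he.1, card_range, he.2]; omega)
    have hred : IsMatchingIn (redGraph c N e) M := ⟨fun p hp => mem_redGraph.2 (by
      obtain ⟨hpN, hp2⟩ := mem_powersetCard.1 (hM.1 hp)
      rw [subset_sdiff] at hpN
      exact ⟨⟨hpN.1, hp2⟩, hpN.2.symm, by simpa using hcon p ⟨hpN.1, hp2⟩ hpN.2.symm⟩), hM.2⟩
    have := h.card_matching_redGraph_lt he hred
    omega
  obtain ⟨S, hS, -⟩ := h.exists_heavySet hR ht htR hN he hf hef hc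
  have hmem : ∀ x ∈ S, x ∈ range N ∧ x ∉ e := by
    intro x hx
    obtain ⟨Y, hY, hYE⟩ := hS.2 x hx
    obtain ⟨y, hy⟩ := card_pos.1 (show 0 < Y.card by omega)
    obtain ⟨⟨h1, -⟩, h2, -⟩ := mem_redGraph.1 (hYE y hy)
    exact ⟨h1 (by simp), disjoint_right.1 h2 (by simp)⟩
  refine ⟨S, fun x hx => (hmem x hx).1, hS.1, disjoint_right.2 fun x hx => (hmem x hx).2, ?_⟩
  intro g hgN hg2 heg hSg
  by_contra hcg
  obtain ⟨S', hS', hSg'⟩ :=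
    h.exists_heavySet hR ht htR hN he ⟨hgN, hg2⟩ heg (by simpa using hcg)
  exact hSg (hSg'.mono_left (h.heavySet_subset he (by omega) hS hS'))

lemma false_of_ramseyProp (h : IsAvoiding c N t)
    {R : ℕ} (hR : RamseyProp R 3 (t - 2)) (ht : 5 ≤ t) (htR : t + 1 ≤ R)
    (hN : N = 2 * R + 2 * t + 1) : False := by
  have he : ({0, 1} : Finset ℕ) ⊆ range N ∧ ({0, 1} : Finset ℕ).card = 2 :=
    ⟨by simp only [insert_subset_iff, singleton_subset_iff, mem_range]; omega, by simp⟩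
  generalize ({0, 1} : Finset ℕ) = e at he
  obtain ⟨S, hSN, hSc, heS, hS⟩ := h.exists_red_cover hR (by omega) htR hN he
  obtain ⟨x, hx⟩ := card_pos.1 (show 0 < S.card by omega)
  obtain ⟨y, hy, hyn⟩ : ∃ y ∈ range N, y ∉ e ∪ S := by
    refine exists_mem_notMem_of_card_lt_card ?_
    have := card_union_le e S
    rw [card_range]
    omega
  rw [mem_union, not_or] at hyn
  have hxy : x ≠ y := fun hxy => hyn.2 (hxy ▸ hx)
  have hf : ({x, y} : Finset ℕ) ⊆ range N ∧ ({x, y} : Finset ℕ).card = 2 :=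
    ⟨by rw [insert_subset_iff, singleton_subset_iff]; exact ⟨hSN hx, hy⟩, card_pair hxy⟩
  have hef : Disjoint e {x, y} := by
    rw [disjoint_insert_right, disjoint_singleton_right]
    exact ⟨disjoint_right.1 heS hx, hyn.1⟩
  have hcef := hS _ hf.1 hf.2 hef (not_disjoint_iff.2 ⟨x, hx, by simp⟩)
  obtain ⟨T, hTN, hTc, hfT, hT⟩ := h.exists_red_cover hR (by omega) htR hN hf
  obtain ⟨z, hz, hze⟩ := exists_mem_notMem_of_card_lt_card (show e.card < T.card by omega)
  have hzf := disjoint_right.1 hfT hz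
  obtain ⟨w, hw, hwn⟩ := exists_mem_notMem_of_card_lt_card
    (show ({x, z} : Finset ℕ).card < S.card by have := card_le_two (a := x) (b := z); omega)
  simp only [mem_insert, mem_singleton, not_or] at hzf hwn
  have hg : ({w, z} : Finset ℕ) ⊆ range N ∧ ({w, z} : Finset ℕ).card = 2 :=
    ⟨by rw [insert_subset_iff, singleton_subset_iff]; exact ⟨hSN hw, hTN hz⟩, card_pair hwn.2⟩
  have heg : Disjoint e {w, z} := by
    rw [disjoint_insert_right, disjoint_singleton_right]
    exact ⟨disjoint_right.1 heS hw, hze⟩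
  have hfg : Disjoint {x, y} ({w, z} : Finset ℕ) := by
    rw [disjoint_insert_right, disjoint_singleton_right, mem_insert, mem_singleton, mem_insert,
      mem_singleton]
    exact ⟨fun h => h.elim hwn.1 fun hwy => hyn.2 (hwy ▸ hw), fun h => h.elim hzf.1 hzf.2⟩
  exact h.not_red_triangle he hf hg hef heg hfg hcef
    (hS _ hg.1 hg.2 heg (not_disjoint_iff.2 ⟨w, hw, by simp⟩))
    (hT _ hg.1 hg.2 hfg (not_disjoint_iff.2 ⟨z, hz, by simp⟩))

end IsAvoiding

/-- If all red degrees are less than `k`, blue cliques can be found greedily. -/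
lemma exists_blue_clique {c : ℕ → ℕ → Bool} (hc : ∀ u v, c u v = c v u) {k : ℕ} (hk : 0 < k)
    {A : Finset ℕ} (hA : ∀ v ∈ A, (A.filter fun u => u ≠ v ∧ c v u = true).card < k) (j : ℕ) :
    ∀ B ⊆ A, j * k ≤ B.card → ∃ S ⊆ B, S.card = j ∧
      ∀ u ∈ S, ∀ v ∈ S, u ≠ v → c u v = false := by
  induction j with
  | zero => exact fun B _ _ => ⟨∅, by simp⟩
  | succ j ih =>
    intro B hB hj
    rw [Nat.succ_mul] at hj
    obtain ⟨v, hv⟩ := card_pos.1 (show 0 < B.card by omega)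
    have hred := hA v (hB hv)
    have hcover : B ⊆ insert v ((A.filter fun u => u ≠ v ∧ c v u = true) ∪
        B.filter fun u => u ≠ v ∧ c v u = false) := by
      intro u hu
      have := hB hu
      cases hvu : c v u <;> by_cases huv : u = v <;> simp [*]
    have h1 := card_le_card hcover
    have h2 := card_insert_le v ((A.filter fun u => u ≠ v ∧ c v u = true) ∪
      B.filter fun u => u ≠ v ∧ c v u = false)
    have h3 := card_union_le (A.filter fun u => u ≠ v ∧ c v u = true)
      (B.filter fun u => u ≠ v ∧ c v u = false)
    obtain ⟨S, hSB, hSj, hS⟩ := ih (B.filter fun u => u ≠ v ∧ c v u = false)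
      ((filter_subset _ _).trans hB) (by omega)
    have hvS : v ∉ S := fun h => (mem_filter.1 (hSB h)).2.1 rfl
    refine ⟨insert v S, insert_subset hv (hSB.trans (filter_subset _ _)), by
      rw [card_insert_of_notMem hvS, hSj], ?_⟩
    intro a ha b hb hab
    rcases mem_insert.1 ha with rfl | haS <;> rcases mem_insert.1 hb with rfl | hbS
    · exact absurd rfl hab
    · exact (mem_filter.1 (hSB hbS)).2.2
    · rw [hc]
      exact (mem_filter.1 (hSB haS)).2.2
    · exact hS a haS b hbS hab

lemma ramseyProp_three {k : ℕ} (hk : 0 < k) : RamseyProp (k * k) 3 k := by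
  intro c hc
  by_cases hA : ∀ v ∈ range (k * k),
      ((range (k * k)).filter fun u => u ≠ v ∧ c v u = true).card < k
  · exact Or.inr (exists_blue_clique hc hk hA k _ subset_rfl (by simp))
  push Not at hA
  obtain ⟨v, hv, hvk⟩ := hA
  by_cases hblue : ∀ a ∈ (range (k * k)).filter fun u => u ≠ v ∧ c v u = true,
      ∀ b ∈ (range (k * k)).filter fun u => u ≠ v ∧ c v u = true, a ≠ b → c a b = false
  · obtain ⟨S, hS, hSk⟩ := exists_subset_card_eq hvk
    exact Or.inr ⟨S, hS.trans (filter_subset _ _), hSk,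
      fun a ha b hb hab => hblue a (hS ha) b (hS hb) hab⟩
  · push Not at hblue
    obtain ⟨a, ha, b, hb, hab, hcab⟩ := hblue
    replace hcab := Bool.eq_true_of_not_eq_false hcab
    obtain ⟨haN, hav, hca⟩ := mem_filter.1 ha
    obtain ⟨hbN, hbv, hcb⟩ := mem_filter.1 hb
    refine Or.inl ⟨{v, a, b}, by simp only [insert_subset_iff, singleton_subset_iff]; tauto,
      card_eq_three.2 ⟨v, a, b, hav.symm, hbv.symm, hab, rfl⟩, ?_⟩
    intro x hx y hy hxy
    simp only [mem_insert, mem_singleton] at hx hy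
    rcases hx with rfl | rfl | rfl <;> rcases hy with rfl | rfl | rfl <;>
      first | exact absurd rfl hxy | assumption | (rw [hc]; assumption)

/-- The coloring of the complete graph on `ℕ` whose red edges form a `5`-cycle on `[5]`. -/
def pentagon (u v : ℕ) : Bool :=
  decide (u < 5 ∧ v < 5 ∧ ((u + 1) % 5 = v ∨ (v + 1) % 5 = u))

lemma pentagon_comm (u v : ℕ) : pentagon u v = pentagon v u := by
  simp only [pentagon, decide_eq_decide]
  tauto

lemma pentagon_no_red_triangle {S : Finset ℕ} (hS : S.card = 3) :
    ¬ ∀ u ∈ S, ∀ v ∈ S, u ≠ v → pentagon u v = true := by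
  intro h
  obtain ⟨x, y, z, hxy, hxz, hyz, rfl⟩ := card_eq_three.1 hS
  have h1 := h x (by simp) y (by simp) hxy
  have h2 := h x (by simp) z (by simp) hxz
  have h3 := h y (by simp) z (by simp) hyz
  simp only [pentagon, decide_eq_true_eq] at h1 h2 h3
  omega

lemma pentagon_blue_card_le {S : Finset ℕ} (hS : S ⊆ range 5)
    (h : ∀ u ∈ S, ∀ v ∈ S, u ≠ v → pentagon u v = false) : S.card ≤ 2 := by
  have key : ∀ S ∈ (range 5).powerset,
      (∀ u ∈ S, ∀ v ∈ S, u ≠ v → pentagon u v = false) → S.card ≤ 2 := by decide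
  exact key S (mem_powerset.2 hS) h

lemma add_two_lt_of_ramseyProp {n k : ℕ} (hk : 3 ≤ k) (h : RamseyProp n 3 k) : k + 2 < n := by
  by_contra! hn
  rcases h pentagon pentagon_comm with ⟨S, -, hS3, hS⟩ | ⟨S, hSn, hSk, hS⟩
  · exact pentagon_no_red_triangle hS3 hS
  · have h1 := pentagon_blue_card_le (S := S ∩ range 5) inter_subset_right
      fun u hu v hv => hS u (mem_inter.1 hu).1 v (mem_inter.1 hv).1
    have h2 : S \ range 5 ⊆ Ico 5 (k + 2) := by
      intro u hu
      rw [mem_sdiff, mem_range] at hu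
      have := mem_range.1 (hSn hu.1)
      rw [mem_Ico]
      omega
    have h3 := card_le_card h2
    rw [Nat.card_Ico] at h3
    have h4 := card_sdiff_add_card_inter S (range 5)
    omega

theorem rkg_two_three_t (t : ℕ) (ht : 5 ≤ t) :
    RKG 2 3 t ≤ 2 * ramseyNumber 3 (t - 2) + 2 * t + 1 := by
  have hR : RamseyProp (ramseyNumber 3 (t - 2)) 3 (t - 2) :=
    Nat.sInf_mem (s := {n | RamseyProp n 3 (t - 2)}) ⟨_, ramseyProp_three (by omega)⟩
  have htR := add_two_lt_of_ramseyProp (by omega) hR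
  refine Nat.sInf_le fun c hc => ?_
  by_contra hcon
  push Not at hcon
  exact IsAvoiding.false_of_ramseyProp ⟨hc, hcon.1, hcon.2⟩ hR ht (by omega) rfl
end

section
/- Every red/blue edge-coloring of the Kneser graph KG(9,2) contains a monochromatic triangle; together with the existence of a triangle-free-coloring of KG(8,2), this gives RKG_2(3,3) = 9. -/
open Finset

/-- The blue half of a coloring of `KG(8,2)` on the vertex set `ℤ/5 ⊔ {5, 6, 7}`: a pair `{x, s}`
with `x < 5 ≤ s` is joined in blue to the pairs containing the successor of `x` in `ℤ/5`, and a pair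
inside `ℤ/5` is joined in blue to the pairs outside it. -/
def BlueFrom (A B : Finset ℕ) : Prop :=
  (∃ x ∈ A, x < 5 ∧ (∃ s ∈ A, 5 ≤ s) ∧ (x + 1) % 5 ∈ B) ∨ (∀ x ∈ A, x < 5) ∧ ∀ x ∈ B, 5 ≤ x

instance (A B : Finset ℕ) : Decidable (BlueFrom A B) := by
  unfold BlueFrom; infer_instance

/-- A coloring of the edges of `KG(8,2)` without monochromatic triangles. -/
def coloringEight (A B : Finset ℕ) : Bool :=
  !(decide (BlueFrom A B) || decide (BlueFrom B A))

theorem coloringEight_comm (A B : Finset ℕ) : coloringEight A B = coloringEight B A := by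
  simp only [coloringEight, Bool.or_comm]

theorem coloringEight_not_mono : ∀ A ∈ powersetCard 2 (range 8), ∀ B ∈ powersetCard 2 (range 8),
    Disjoint A B → ∀ C ∈ powersetCard 2 (range 8), Disjoint A C → Disjoint B C →
      ¬(coloringEight A B = coloringEight A C ∧ coloringEight A B = coloringEight B C) := by
  decide +kernel

theorem exists_of_isKneserClique_card_three {n r : ℕ} {c : Finset ℕ → Finset ℕ → Bool} {b : Bool}
    {S : Finset (Finset ℕ)} (hS : IsKneserClique n r S) (hcard : S.card = 3)
    (hmono : MonoClique c b S) :
    ∃ A ∈ powersetCard r (range n), ∃ B ∈ powersetCard r (range n),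
      ∃ C ∈ powersetCard r (range n), Disjoint A B ∧ Disjoint A C ∧ Disjoint B C ∧
        c A B = b ∧ c A C = b ∧ c B C = b := by
  obtain ⟨A, B, C, hAB, hAC, hBC, rfl⟩ := card_eq_three.mp hcard
  have hA : A ∈ ({A, B, C} : Finset (Finset ℕ)) := by simp
  have hB : B ∈ ({A, B, C} : Finset (Finset ℕ)) := by simp
  have hC : C ∈ ({A, B, C} : Finset (Finset ℕ)) := by simp
  exact ⟨A, mem_powersetCard.mpr (hS.1 A hA), B, mem_powersetCard.mpr (hS.1 B hB),
    C, mem_powersetCard.mpr (hS.1 C hC), hS.2 hA hB hAB, hS.2 hA hC hAC, hS.2 hB hC hBC,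
    hmono A hA B hB hAB, hmono A hA C hC hAC, hmono B hB C hC hBC⟩

theorem not_kneserRamseyProp_of_le_eight {n : ℕ} (hn : n ≤ 8) : ¬KneserRamseyProp n 2 3 3 := by
  intro h
  have key : ∀ (b : Bool) (S : Finset (Finset ℕ)), IsKneserClique n 2 S → S.card = 3 →
      ¬MonoClique coloringEight b S := by
    intro b S hS hcard hmono
    obtain ⟨A, hA, B, hB, C, hC, hAB, hAC, hBC, h₁, h₂, h₃⟩ :=
      exists_of_isKneserClique_card_three hS hcard hmono
    have hsub := powersetCard_mono (n := 2) (range_subset_range.mpr hn)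
    exact coloringEight_not_mono A (hsub hA) B (hsub hB) hAB C (hsub hC) hAC hBC
      ⟨h₁.trans h₂.symm, h₁.trans h₃.symm⟩
  rcases h coloringEight coloringEight_comm with ⟨S, hS, hcard, hmono⟩ | ⟨S, hS, hcard, hmono⟩
  · exact key _ S hS hcard hmono
  · exact key _ S hS hcard hmono

/-- Three pairwise disjoint pairs, that is, a triangle of `KG(9,2)`. -/
abbrev IsTriangle (A B C : Finset (Fin 9)) : Prop :=
  (A.card = 2 ∧ B.card = 2 ∧ C.card = 2) ∧ Disjoint A B ∧ Disjoint A C ∧ Disjoint B C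

/-- The coloring `c` of the edges of `KG(9,2)` has no monochromatic triangle. -/
def NoMonoTriangle (c : Finset (Fin 9) → Finset (Fin 9) → Bool) : Prop :=
  ∀ ⦃A B C : Finset (Fin 9)⦄ (b : Bool), c A B = b → c A C = b → c B C = b → ¬IsTriangle A B C

/-- The coloring obtained from `c` by renaming the vertices of the ground set. -/
def permute (σ : Equiv.Perm (Fin 9)) (c : Finset (Fin 9) → Finset (Fin 9) → Bool)
    (A B : Finset (Fin 9)) : Bool :=
  c (A.map σ.toEmbedding) (B.map σ.toEmbedding)

theorem permute_eq {σ : Equiv.Perm (Fin 9)} {c : Finset (Fin 9) → Finset (Fin 9) → Bool}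
    {A B A' B' : Finset (Fin 9)} {b : Bool} (h : c A' B' = b)
    (hA : A.map σ.toEmbedding = A' := by decide) (hB : B.map σ.toEmbedding = B' := by decide) :
    permute σ c A B = b := by
  rw [permute, hA, hB, h]

namespace NoMonoTriangle

variable {c : Finset (Fin 9) → Finset (Fin 9) → Bool} {A B C D : Finset (Fin 9)} {b : Bool}

theorem left (hc : NoMonoTriangle c) (h₁ : c A B = b) (h₂ : c A C = b)
    (h : IsTriangle A B C := by decide) : c B C = !b :=
  Bool.eq_not.mpr fun h₃ ↦ hc b h₁ h₂ h₃ h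

theorem mid (hc : NoMonoTriangle c) (h₁ : c A B = b) (h₂ : c B C = b)
    (h : IsTriangle A B C := by decide) : c A C = !b :=
  Bool.eq_not.mpr fun h₃ ↦ hc b h₁ h₃ h₂ h

theorem right (hc : NoMonoTriangle c) (h₁ : c A C = b) (h₂ : c B C = b)
    (h : IsTriangle A B C := by decide) : c A B = !b :=
  Bool.eq_not.mpr fun h₃ ↦ hc b h₃ h₁ h₂ h

/-- The neighborhood of a vertex `D` in one color contains no triangle at all. -/
theorem matching (hc : NoMonoTriangle c) (h₁ : c A D = b) (h₂ : c B D = b)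
    (h : IsTriangle A B C := by decide)
    (hD : IsTriangle A B D ∧ IsTriangle A C D ∧ IsTriangle B C D := by decide) :
    c C D = !b :=
  Bool.eq_not.mpr fun h₃ ↦
    hc (!b) (hc.right h₁ h₂ hD.1) (hc.right h₁ h₃ hD.2.1) (hc.right h₂ h₃ hD.2.2) h

theorem permute (hc : NoMonoTriangle c) (σ : Equiv.Perm (Fin 9)) :
    NoMonoTriangle (permute σ c) := by
  intro A B C b h₁ h₂ h₃ h
  refine hc b h₁ h₂ h₃ ?_
  simpa only [IsTriangle, card_map, disjoint_map] using h

theorem not (hc : NoMonoTriangle c) : NoMonoTriangle fun A B ↦ !c A B :=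
  fun _ _ _ b h₁ h₂ h₃ ↦
    hc (!b) (Bool.not_eq_eq_eq_not.mp h₁) (Bool.not_eq_eq_eq_not.mp h₂)
      (Bool.not_eq_eq_eq_not.mp h₃)

/-- If `c` has the color `false` on the edges from `{7, 8}` to the pairs in the triangle `2, 3, 4` and
to `{0, 1}`, and `true` on those to `{1, 5}` and to the pairs joining `6` to the triangle, then all
edges at `{7, 8}` are determined, and they force a monochromatic triangle. -/
theorem not_of_triangle_star (hc : NoMonoTriangle c)
    (h23_78 : c {2, 3} {7, 8} = false) (h24_78 : c {2, 4} {7, 8} = false)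
    (h34_78 : c {3, 4} {7, 8} = false) (h01_78 : c {0, 1} {7, 8} = false)
    (h15_78 : c {1, 5} {7, 8} = true) (h26_78 : c {2, 6} {7, 8} = true)
    (h36_78 : c {3, 6} {7, 8} = true) (h46_78 : c {4, 6} {7, 8} = true) :
    False := by
  -- the colors of the edges at `{7, 8}`
  have h45_78 : c {4, 5} {7, 8} = true := hc.matching h01_78 h23_78
  have h35_78 : c {3, 5} {7, 8} = true := hc.matching h01_78 h24_78
  have h25_78 : c {2, 5} {7, 8} = true := hc.matching h01_78 h34_78
  have h02_78 : c {0, 2} {7, 8} = false := hc.matching h15_78 h36_78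
  have h04_78 : c {0, 4} {7, 8} = false := hc.matching h15_78 h26_78
  have h13_78 : c {1, 3} {7, 8} = false := hc.matching h26_78 h45_78
  have h14_78 : c {1, 4} {7, 8} = false := hc.matching h26_78 h35_78
  have h16_78 : c {1, 6} {7, 8} = true := hc.matching h02_78 h34_78
  have h05_78 : c {0, 5} {7, 8} = true := hc.matching h13_78 h24_78
  have h06_78 : c {0, 6} {7, 8} = true := hc.matching h13_78 h24_78
  have h02_13 : c {0, 2} {1, 3} = true := hc.right h02_78 h13_78
  cases h01_45 : c {0, 1} {4, 5} with
  | false =>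
    have h02_34 : c {0, 2} {3, 4} = true := hc.right h02_78 h34_78
    have h15_26 : c {1, 5} {2, 6} = false := hc.right h15_78 h26_78
    have h26_45 : c {2, 6} {4, 5} = false := hc.right h26_78 h45_78
    have h01_26 : c {0, 1} {2, 6} = true := hc.right h01_45 h26_45
    have h01_34 : c {0, 1} {3, 4} = true := hc.right h01_78 h34_78
    have h26_34 : c {2, 6} {3, 4} = false := hc.left h01_26 h01_34
    have h15_34 : c {1, 5} {3, 4} = true := hc.mid h15_26 h26_34
    have h02_15 : c {0, 2} {1, 5} = false := hc.right h02_34 h15_34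
    have h05_36 : c {0, 5} {3, 6} = false := hc.right h05_78 h36_78
    have h01_24 : c {0, 1} {2, 4} = true := hc.right h01_78 h24_78
    have h36_45 : c {3, 6} {4, 5} = false := hc.right h36_78 h45_78
    have h01_36 : c {0, 1} {3, 6} = true := hc.right h01_45 h36_45
    have h24_36 : c {2, 4} {3, 6} = false := hc.left h01_24 h01_36
    have h05_24 : c {0, 5} {2, 4} = true := hc.right h05_36 h24_36
    have h13_24 : c {1, 3} {2, 4} = true := hc.right h13_78 h24_78
    have h05_13 : c {0, 5} {1, 3} = false := hc.right h05_24 h13_24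
    have h05_46 : c {0, 5} {4, 6} = false := hc.right h05_78 h46_78
    have h13_46 : c {1, 3} {4, 6} = true := hc.left h05_13 h05_46
    have h02_46 : c {0, 2} {4, 6} = false := hc.mid h02_13 h13_46
    have h15_46 : c {1, 5} {4, 6} = false := hc.right h15_78 h46_78
    exact hc _ h02_15 h02_46 h15_46 (by decide)
  | true =>
    have h04_13 : c {0, 4} {1, 3} = true := hc.right h04_78 h13_78
    have h04_23 : c {0, 4} {2, 3} = true := hc.right h04_78 h23_78
    have h16_45 : c {1, 6} {4, 5} = false := hc.right h16_78 h45_78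
    have h01_23 : c {0, 1} {2, 3} = true := hc.right h01_78 h23_78
    have h23_45 : c {2, 3} {4, 5} = false := hc.left h01_23 h01_45
    have h16_23 : c {1, 6} {2, 3} = true := hc.right h16_45 h23_45
    have h04_16 : c {0, 4} {1, 6} = false := hc.right h04_23 h16_23
    have h16_25 : c {1, 6} {2, 5} = false := hc.right h16_78 h25_78
    have h04_25 : c {0, 4} {2, 5} = true := hc.mid h04_16 h16_25
    have h13_25 : c {1, 3} {2, 5} = false := hc.left h04_13 h04_25
    have h02_14 : c {0, 2} {1, 4} = true := hc.right h02_78 h14_78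
    have h06_45 : c {0, 6} {4, 5} = false := hc.right h06_78 h45_78
    have h06_23 : c {0, 6} {2, 3} = true := hc.right h06_45 h23_45
    have h14_23 : c {1, 4} {2, 3} = true := hc.right h14_78 h23_78
    have h06_14 : c {0, 6} {1, 4} = false := hc.right h06_23 h14_23
    have h06_35 : c {0, 6} {3, 5} = false := hc.right h06_78 h35_78
    have h14_35 : c {1, 4} {3, 5} = true := hc.left h06_14 h06_35
    have h02_35 : c {0, 2} {3, 5} = false := hc.mid h02_14 h14_35
    have h35_46 : c {3, 5} {4, 6} = false := hc.right h35_78 h46_78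
    have h02_46 : c {0, 2} {4, 6} = true := hc.mid h02_35 h35_46
    have h13_46 : c {1, 3} {4, 6} = false := hc.left h02_13 h02_46
    have h25_46 : c {2, 5} {4, 6} = false := hc.right h25_78 h46_78
    exact hc _ h13_25 h13_46 h25_46 (by decide)

theorem not_of_triangle_star' (hc : NoMonoTriangle c)
    (h23_78 : c {2, 3} {7, 8} = true) (h24_78 : c {2, 4} {7, 8} = true)
    (h34_78 : c {3, 4} {7, 8} = true) (h01_78 : c {0, 1} {7, 8} = false)
    (h15_78 : c {1, 5} {7, 8} = true) (h26_78 : c {2, 6} {7, 8} = false)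
    (h36_78 : c {3, 6} {7, 8} = false) (h46_78 : c {4, 6} {7, 8} = false) :
    False :=
  not_of_triangle_star (hc.permute (Equiv.swap 0 5)).not
    (congrArg Bool.not (permute_eq h23_78)) (congrArg Bool.not (permute_eq h24_78))
    (congrArg Bool.not (permute_eq h34_78)) (congrArg Bool.not (permute_eq h15_78))
    (congrArg Bool.not (permute_eq h01_78)) (congrArg Bool.not (permute_eq h26_78))
    (congrArg Bool.not (permute_eq h36_78)) (congrArg Bool.not (permute_eq h46_78))

/-- The four remaining vertices `2, 3, 4, 6` have three perfect matchings, none of which is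
monochromatic, so they form a triangle in one color and a star in the other. -/
theorem not_of_path (hc : NoMonoTriangle c) (h01_78 : c {0, 1} {7, 8} = false)
    (h15_78 : c {1, 5} {7, 8} = true) : False := by
  cases h23_78 : c {2, 3} {7, 8} <;> cases h24_78 : c {2, 4} {7, 8} <;>
    cases h34_78 : c {3, 4} {7, 8}
  · have h26_78 := hc.matching (C := {2, 6}) h01_78 h34_78
    have h36_78 := hc.matching (C := {3, 6}) h01_78 h24_78
    have h46_78 := hc.matching (C := {4, 6}) h01_78 h23_78
    exact not_of_triangle_star hc h23_78 h24_78 h34_78 h01_78 h15_78 h26_78 h36_78 h46_78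
  · have h26_78 := hc.matching (C := {2, 6}) h15_78 h34_78
    have h36_78 := hc.matching (C := {3, 6}) h01_78 h24_78
    have h46_78 := hc.matching (C := {4, 6}) h01_78 h23_78
    exact not_of_triangle_star' (hc.permute (Equiv.swap 2 6))
      (permute_eq h36_78) (permute_eq h46_78) (permute_eq h34_78) (permute_eq h01_78)
      (permute_eq h15_78) (permute_eq h26_78) (permute_eq h23_78) (permute_eq h24_78)
  · have h26_78 := hc.matching (C := {2, 6}) h01_78 h34_78
    have h36_78 := hc.matching (C := {3, 6}) h15_78 h24_78
    have h46_78 := hc.matching (C := {4, 6}) h01_78 h23_78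
    exact not_of_triangle_star' (hc.permute (Equiv.swap 3 6))
      (permute_eq h26_78) (permute_eq h24_78) (permute_eq h46_78) (permute_eq h01_78)
      (permute_eq h15_78) (permute_eq h23_78) (permute_eq h36_78) (permute_eq h34_78)
  · have h26_78 := hc.matching (C := {2, 6}) h15_78 h34_78
    have h36_78 := hc.matching (C := {3, 6}) h15_78 h24_78
    have h46_78 := hc.matching (C := {4, 6}) h01_78 h23_78
    exact not_of_triangle_star (hc.permute (Equiv.swap 4 6))
      (permute_eq h23_78) (permute_eq h26_78) (permute_eq h36_78) (permute_eq h01_78)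
      (permute_eq h15_78) (permute_eq h24_78) (permute_eq h34_78) (permute_eq h46_78)
  · have h26_78 := hc.matching (C := {2, 6}) h01_78 h34_78
    have h36_78 := hc.matching (C := {3, 6}) h01_78 h24_78
    have h46_78 := hc.matching (C := {4, 6}) h15_78 h23_78
    exact not_of_triangle_star' (hc.permute (Equiv.swap 4 6))
      (permute_eq h23_78) (permute_eq h26_78) (permute_eq h36_78) (permute_eq h01_78)
      (permute_eq h15_78) (permute_eq h24_78) (permute_eq h34_78) (permute_eq h46_78)
  · have h26_78 := hc.matching (C := {2, 6}) h15_78 h34_78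
    have h36_78 := hc.matching (C := {3, 6}) h01_78 h24_78
    have h46_78 := hc.matching (C := {4, 6}) h15_78 h23_78
    exact not_of_triangle_star (hc.permute (Equiv.swap 3 6))
      (permute_eq h26_78) (permute_eq h24_78) (permute_eq h46_78) (permute_eq h01_78)
      (permute_eq h15_78) (permute_eq h23_78) (permute_eq h36_78) (permute_eq h34_78)
  · have h26_78 := hc.matching (C := {2, 6}) h01_78 h34_78
    have h36_78 := hc.matching (C := {3, 6}) h15_78 h24_78
    have h46_78 := hc.matching (C := {4, 6}) h15_78 h23_78
    exact not_of_triangle_star (hc.permute (Equiv.swap 2 6))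
      (permute_eq h36_78) (permute_eq h46_78) (permute_eq h34_78) (permute_eq h01_78)
      (permute_eq h15_78) (permute_eq h26_78) (permute_eq h23_78) (permute_eq h24_78)
  · have h26_78 := hc.matching (C := {2, 6}) h15_78 h34_78
    have h36_78 := hc.matching (C := {3, 6}) h15_78 h24_78
    have h46_78 := hc.matching (C := {4, 6}) h15_78 h23_78
    exact not_of_triangle_star' hc h23_78 h24_78 h34_78 h01_78 h15_78 h26_78 h36_78 h46_78

theorem path_eq (hc : NoMonoTriangle c) : c {0, 1} {7, 8} = c {1, 5} {7, 8} := by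
  cases h01_78 : c {0, 1} {7, 8} <;> cases h15_78 : c {1, 5} {7, 8}
  · rfl
  · exact (hc.not_of_path h01_78 h15_78).elim
  · exact (hc.not.not_of_path (congrArg Bool.not h01_78) (congrArg Bool.not h15_78)).elim
  · rfl

theorem permute_path_eq (hc : NoMonoTriangle c) (σ : Equiv.Perm (Fin 9)) {A B : Finset (Fin 9)}
    (hA : ({0, 1} : Finset (Fin 9)).map σ.toEmbedding = A := by decide)
    (hB : ({1, 5} : Finset (Fin 9)).map σ.toEmbedding = B := by decide)
    (hD : ({7, 8} : Finset (Fin 9)).map σ.toEmbedding = {7, 8} := by decide) :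
    c A {7, 8} = c B {7, 8} := by
  rw [← hA, ← hB, ← hD]
  exact (hc.permute σ).path_eq

end NoMonoTriangle

/-- Every coloring of the edges of `KG(9,2)` has a monochromatic triangle. -/
theorem not_noMonoTriangle (c : Finset (Fin 9) → Finset (Fin 9) → Bool) : ¬NoMonoTriangle c := by
  intro hc
  have h₁ : c {0, 1} {7, 8} = c {1, 5} {7, 8} := hc.path_eq
  have h₂ : c {1, 5} {7, 8} = c {2, 5} {7, 8} := hc.permute_path_eq c[0, 1, 5, 2, 3, 4]
  have h₃ : c {2, 5} {7, 8} = c {2, 3} {7, 8} := hc.permute_path_eq (c[0, 1, 5, 2, 3, 4] ^ 2)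
  have h₄ : c {2, 3} {7, 8} = c {3, 4} {7, 8} := hc.permute_path_eq (c[0, 1, 5, 2, 3, 4] ^ 3)
  have h₅ : c {3, 4} {7, 8} = !c {0, 1} {7, 8} :=
    hc.matching (A := {0, 1}) (B := {2, 5}) rfl (h₁.trans h₂).symm
  rw [h₁, h₂, h₃, h₄] at h₅
  exact Bool.not_ne_self _ h₅.symm

theorem kneserRamseyProp_nine : KneserRamseyProp 9 2 3 3 := by
  intro c hsymm
  have hmap (A : Finset (Fin 9)) : A.map Fin.valEmbedding ⊆ range 9 := by
    intro x hx
    obtain ⟨i, -, rfl⟩ := mem_map.mp hx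
    exact mem_range.mpr i.isLt
  obtain ⟨A, B, C, b, h₁, h₂, h₃, ⟨hA, hB, hC⟩, hAB, hAC, hBC⟩ :
      ∃ A B C b, c (A.map Fin.valEmbedding) (B.map Fin.valEmbedding) = b ∧
        c (A.map Fin.valEmbedding) (C.map Fin.valEmbedding) = b ∧
        c (B.map Fin.valEmbedding) (C.map Fin.valEmbedding) = b ∧ IsTriangle A B C := by
    by_contra! h
    exact not_noMonoTriangle _ fun A B C b h₁ h₂ h₃ ↦ h A B C b h₁ h₂ h₃
  obtain ⟨S, hS, hcard, hmono⟩ : ∃ S, IsKneserClique 9 2 S ∧ S.card = 3 ∧ MonoClique c b S := by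
    have hne {X Y : Finset (Fin 9)} (hX : X.card = 2) (hXY : Disjoint X Y) :
        X.map Fin.valEmbedding ≠ Y.map Fin.valEmbedding := by
      rintro h
      obtain rfl := map_injective _ h
      simp [disjoint_self.mp hXY] at hX
    refine ⟨{A.map Fin.valEmbedding, B.map Fin.valEmbedding, C.map Fin.valEmbedding},
      ⟨?_, ?_⟩, card_eq_three.mpr ⟨_, _, _, hne hA hAB, hne hA hAC, hne hB hBC, rfl⟩, ?_⟩
    · simp [hmap, hA, hB, hC]
    · simp [Set.Pairwise, hAB, hAC, hBC, hAB.symm, hAC.symm, hBC.symm]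
    · simp [MonoClique, h₁, h₂, h₃, hsymm (B.map _) (A.map _), hsymm (C.map _) (A.map _),
        hsymm (C.map _) (B.map _)]
  cases b
  · exact Or.inr ⟨S, hS, hcard, hmono⟩
  · exact Or.inl ⟨S, hS, hcard, hmono⟩

theorem rkg_two_three_three_eq_nine :
    KneserRamseyProp 9 2 3 3 ∧ RKG 2 3 3 = 9 := by
  refine ⟨kneserRamseyProp_nine, le_antisymm (Nat.sInf_le kneserRamseyProp_nine) ?_⟩
  refine le_csInf ⟨9, kneserRamseyProp_nine⟩ fun n hn ↦ ?_
  by_contra! h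
  exact not_kneserRamseyProp_of_le_eight (Nat.lt_succ_iff.mp h) hn
end
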